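/- arXiv:2601.01670 — 2 statements merged into one kernel-verified Lean document; each statement's English description precedes it below -/
import Mathlib

section
/- Let λ>0 and assume (A1)–(A4) with f and g globally Lipschitz continuous in their last two arguments on their whole domain (i.e., the Lipschitz constants L₁ and L₂ do not depend on M), and assume moreover that g(t,u,w)<1 for all t∈[0,T], u∈ℝⁿ, and w∈[0,∞). Then the impulsive initial value problem has a unique solution (x,τ) on (−∞,T], and there exist nonnegative constants M₁, M₂, M₃ such that: τ(t)>0 for t∈[0,T]; |x(t)|+τ(t) ≤ M₁ for t∈(−∞,T]; |x(t)−x(t̄)| ≤ M₂|t−t̄| whenever t,t̄ lie in the same interval between consecutive points of {−λ,…,t_{−1},0,t₁,…,t_K,T} (the impulsive moments together with the discontinuity points of φ in [−λ,0]); and |τ(t)−τ(t̄)| ≤ M₃|t−t̄| for all t,t̄∈[0,T]. -/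
open Set Filter MeasureTheory

/-- The piecewise-constant argument `[t]_h = ⌊t/h⌋·h`. -/
noncomputable def flr (h t : ℝ) : ℝ := ⌊t / h⌋ * h

/-- `(x, τ)` is a solution of the EPCA impulsive initial value problem
(with stepsize `h`) on `(-∞, β]`: the initial conditions `x = φ`, `τ = λ`
hold on `(-∞,0]`, `τ` is continuous on `[0,β]` and satisfies the integral
equation with piecewise-constant arguments, `x` is right-continuous, has
left limits at the impulsive moments `tI 1 < ⋯ < tI K` where it jumps by
`Imp k` applied to the left limit, and `x` satisfies the integral equation
with piecewise-constant arguments on every subinterval of `[0,β]` containing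
no impulsive moment. -/
def IsEPCASol (n K : ℕ) (f : ℝ → (Fin n → ℝ) → (Fin n → ℝ) → (Fin n → ℝ))
    (g : ℝ → (Fin n → ℝ) → ℝ → ℝ) (Imp : ℕ → (Fin n → ℝ) → (Fin n → ℝ))
    (φ : ℝ → (Fin n → ℝ)) (lam : ℝ) (tI : ℕ → ℝ)
    (h β : ℝ) (x : ℝ → (Fin n → ℝ)) (τ : ℝ → ℝ) : Prop :=
  (∀ t ≤ (0 : ℝ), x t = φ t) ∧ (∀ t ≤ (0 : ℝ), τ t = lam) ∧
  ContinuousOn τ (Icc 0 β) ∧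
  (∀ t ∈ Icc (0 : ℝ) β,
    τ t = lam + ∫ s in (0 : ℝ)..t, g (flr h s) (x (flr h s)) (τ (flr h s))) ∧
  (∀ t ∈ Icc (0 : ℝ) β, Tendsto x (nhdsWithin t (Ici t)) (nhds (x t))) ∧
  (∀ k, 1 ≤ k → k ≤ K → tI k ≤ β →
    ∃ ξ, Tendsto x (nhdsWithin (tI k) (Iio (tI k))) (nhds ξ) ∧
      x (tI k) = ξ + Imp k ξ) ∧
  (∀ a b : ℝ, 0 ≤ a → a ≤ b → b ≤ β →
    (∀ k, 1 ≤ k → k ≤ K → tI k ∉ Ioc a b) →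
    x b = x a + ∫ s in a..b,
      f (flr h s) (x (flr h s)) (x (flr h s - flr h (τ (flr h s)))))

/-- `(x, τ)` is a solution of the impulsive initial value problem with
state-dependent adaptive delay on `(-∞, β]`. -/
def IsIIVPSol (n K : ℕ) (f : ℝ → (Fin n → ℝ) → (Fin n → ℝ) → (Fin n → ℝ))
    (g : ℝ → (Fin n → ℝ) → ℝ → ℝ) (Imp : ℕ → (Fin n → ℝ) → (Fin n → ℝ))
    (φ : ℝ → (Fin n → ℝ)) (lam : ℝ) (tI : ℕ → ℝ)
    (β : ℝ) (x : ℝ → (Fin n → ℝ)) (τ : ℝ → ℝ) : Prop :=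
  (∀ t ≤ (0 : ℝ), x t = φ t) ∧ (∀ t ≤ (0 : ℝ), τ t = lam) ∧
  ContinuousOn τ (Icc 0 β) ∧
  (∀ t ∈ Icc (0 : ℝ) β, τ t = lam + ∫ s in (0 : ℝ)..t, g s (x s) (τ s)) ∧
  (∀ t ∈ Icc (0 : ℝ) β, Tendsto x (nhdsWithin t (Ici t)) (nhds (x t))) ∧
  (∀ k, 1 ≤ k → k ≤ K → tI k ≤ β →
    ∃ ξ, Tendsto x (nhdsWithin (tI k) (Iio (tI k))) (nhds ξ) ∧
      x (tI k) = ξ + Imp k ξ) ∧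
  (∀ a b : ℝ, 0 ≤ a → a ≤ b → b ≤ β →
    (∀ k, 1 ≤ k → k ≤ K → tI k ∉ Ioc a b) →
    x b = x a + ∫ s in a..b, f s (x s) (x (s - τ s)))

/-- (A1): `f` is continuous on `[0,T]×ℝⁿ×ℝⁿ` and locally Lipschitz
continuous in its second and third arguments. -/
def AssumptionA1 (n : ℕ) (T : ℝ)
    (f : ℝ → (Fin n → ℝ) → (Fin n → ℝ) → (Fin n → ℝ)) : Prop :=
  ContinuousOn (fun p : ℝ × (Fin n → ℝ) × (Fin n → ℝ) => f p.1 p.2.1 p.2.2)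
    (Icc 0 T ×ˢ (univ : Set (Fin n → ℝ)) ×ˢ (univ : Set (Fin n → ℝ))) ∧
  ∀ M : ℝ, 0 < M → ∃ L : ℝ, 0 ≤ L ∧ ∀ t ∈ Icc (0 : ℝ) T,
    ∀ u ub v vb : Fin n → ℝ, ‖u‖ ≤ M → ‖ub‖ ≤ M → ‖v‖ ≤ M → ‖vb‖ ≤ M →
      ‖f t u v - f t ub vb‖ ≤ L * (‖u - ub‖ + ‖v - vb‖)

/-- (A2): `g` is continuous on `[0,T]×ℝⁿ×ℝ`, is positive when its last
argument vanishes, and is locally Lipschitz continuous in its second and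
third arguments. -/
def AssumptionA2 (n : ℕ) (T : ℝ) (g : ℝ → (Fin n → ℝ) → ℝ → ℝ) : Prop :=
  ContinuousOn (fun p : ℝ × (Fin n → ℝ) × ℝ => g p.1 p.2.1 p.2.2)
    (Icc 0 T ×ˢ (univ : Set (Fin n → ℝ)) ×ˢ (univ : Set ℝ)) ∧
  (∀ t ∈ Icc (0 : ℝ) T, ∀ u : Fin n → ℝ, 0 < g t u 0) ∧
  ∀ M : ℝ, 0 < M → ∃ L : ℝ, 0 ≤ L ∧ ∀ t ∈ Icc (0 : ℝ) T,
    ∀ u ub : Fin n → ℝ, ∀ w wb : ℝ, ‖u‖ ≤ M → ‖ub‖ ≤ M → |w| ≤ M → |wb| ≤ M →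
      |g t u w - g t ub wb| ≤ L * (‖u - ub‖ + |w - wb|)

/-- (A3): the impulse functions `I_k`, `k = 1,…,K`, are globally Lipschitz
continuous with a common Lipschitz constant. -/
def AssumptionA3 (n K : ℕ) (Imp : ℕ → (Fin n → ℝ) → (Fin n → ℝ)) : Prop :=
  ∃ L : ℝ, 0 ≤ L ∧ ∀ k, 1 ≤ k → k ≤ K → ∀ u ub : Fin n → ℝ,
    ‖Imp k u - Imp k ub‖ ≤ L * ‖u - ub‖

/-- (A4): the initial function `φ` is bounded on `(-∞,0]` and locally
piecewise Lipschitz continuous, with possible jump discontinuities only at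
the points of the strictly decreasing sequence `0 = tm 0 > tm 1 > ⋯ → -∞`,
where it is right-continuous. -/
def AssumptionA4 (n : ℕ) (φ : ℝ → (Fin n → ℝ)) (tm : ℕ → ℝ) : Prop :=
  tm 0 = 0 ∧ StrictAnti tm ∧ Tendsto tm atTop atBot ∧
  (∀ k : ℕ, Tendsto φ (nhdsWithin (tm k) (Ioi (tm k))) (nhds (φ (tm k)))) ∧
  (∃ N : ℝ, 0 ≤ N ∧ ∀ s ≤ (0 : ℝ), ‖φ s‖ ≤ N) ∧
  (∀ M : ℝ, 0 < M → ∃ L : ℝ, 0 ≤ L ∧ ∀ k : ℕ,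
    ∀ s ∈ Ico (tm (k + 1)) (tm k) ∩ Icc (-M) 0,
    ∀ sb ∈ Ico (tm (k + 1)) (tm k) ∩ Icc (-M) 0,
      ‖φ s - φ sb‖ ≤ L * |s - sb|)

/-- Induction along a real interval: a property which passes to a point from everything to its left,
and which propagates slightly to the right, holds on the whole interval. -/
theorem forall_mem_Icc_of_left_of_right {P : ℝ → Prop} {a b : ℝ}
    (hleft : ∀ t ∈ Icc a b, (∀ s ∈ Ico a t, P s) → P t)
    (hright : ∀ t ∈ Ico a b, (∀ s ∈ Icc a t, P s) → ∃ u > t, ∀ s ∈ Ioo t u, P s) :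
    ∀ t ∈ Icc a b, P t := by
  by_contra! hcon
  obtain ⟨t₁, ht₁, hnt₁⟩ := hcon
  set S := {t | t ∈ Icc a b ∧ ¬ P t} with hS
  have hne : S.Nonempty := ⟨t₁, ht₁, hnt₁⟩
  have hbdd : BddBelow S := ⟨a, fun t ht => ht.1.1⟩
  set c := sInf S with hc
  have hac : a ≤ c := le_csInf hne fun t ht => ht.1.1
  have hct₁ : c ≤ t₁ := csInf_le hbdd ⟨ht₁, hnt₁⟩
  have hlt : ∀ s ∈ Ico a c, P s := fun s hs => by
    by_contra hn
    exact absurd (csInf_le hbdd (show s ∈ S from ⟨⟨hs.1, by linarith [hs.2, ht₁.2]⟩, hn⟩))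
      (not_le.2 hs.2)
  have hPc : P c := hleft c ⟨hac, hct₁.trans ht₁.2⟩ hlt
  have hcb : c < b := by
    refine lt_of_le_of_ne (hct₁.trans ht₁.2) fun h => ?_
    exact hnt₁ ((le_antisymm hct₁ (h ▸ ht₁.2)) ▸ hPc)
  have hle : ∀ s ∈ Icc a c, P s := fun s hs => by
    rcases hs.2.lt_or_eq with h | h
    · exact hlt s ⟨hs.1, h⟩
    · exact h ▸ hPc
  obtain ⟨u, hu, hPu⟩ := hright c ⟨hac, hcb⟩ hle
  obtain ⟨s, hs, hsu⟩ := exists_lt_of_csInf_lt hne (show sInf S < u from hu)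
  rcases (csInf_le hbdd hs).lt_or_eq with h | h
  · exact hs.2 (hPu s ⟨h, hsu⟩)
  · exact hs.2 (h ▸ hPc)

/-- A right-continuous function of a real variable is Borel measurable. -/
theorem measurable_of_forall_tendsto_nhdsGE {E : Type*} [TopologicalSpace E]
    [TopologicalSpace.PseudoMetrizableSpace E] [MeasurableSpace E] [BorelSpace E] {x : ℝ → E}
    (hx : ∀ t, Tendsto x (nhdsWithin t (Ici t)) (nhds (x t))) : Measurable x := by
  refine measurable_of_tendsto_metrizable
    (f := fun (m : ℕ) (t : ℝ) => x (((⌊t * (m + 1)⌋ + 1 : ℤ) : ℝ) / (m + 1))) (fun m => ?_) ?_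
  · have h1 : Measurable fun t : ℝ => ⌊t * ((m : ℝ) + 1)⌋ :=
      Int.measurable_floor.comp (measurable_id.mul_const _)
    exact (measurable_from_top (f := fun j : ℤ => x (((j + 1 : ℤ) : ℝ) / ((m : ℝ) + 1)))).comp h1
  · rw [tendsto_pi_nhds]
    intro t
    have hlow : ∀ m : ℕ, t ≤ ((⌊t * ((m : ℝ) + 1)⌋ + 1 : ℤ) : ℝ) / ((m : ℝ) + 1) := fun m => by
      rw [le_div_iff₀ (by positivity)]
      push_cast
      exact (Int.lt_floor_add_one _).le
    have hup : ∀ m : ℕ, ((⌊t * ((m : ℝ) + 1)⌋ + 1 : ℤ) : ℝ) / ((m : ℝ) + 1)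
        ≤ t + 1 / ((m : ℝ) + 1) := fun m => by
      rw [div_le_iff₀ (by positivity), add_mul, one_div, inv_mul_cancel₀ (by positivity)]
      push_cast
      linarith [Int.floor_le (t * ((m : ℝ) + 1))]
    refine (hx t).comp (tendsto_nhdsWithin_iff.2 ⟨?_, Eventually.of_forall hlow⟩)
    refine tendsto_of_tendsto_of_tendsto_of_le_of_le tendsto_const_nhds ?_ hlow hup
    simpa using (tendsto_const_nhds (x := t)).add
      (tendsto_one_div_add_atTop_nhds_zero_nat (𝕜 := ℝ))

/-- A Grönwall-type bound for a delay integral equation with an integrand of linear growth. -/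
theorem norm_le_exp_of_eq_add_integral {E : Type*} [NormedAddCommGroup E] [NormedSpace ℝ E]
    {x F : ℝ → E} {σ : ℝ → ℝ} {a b A C L : ℝ} (hA : 0 ≤ A) (hC : 0 ≤ C) (hL : 0 ≤ L)
    (hx : ∀ s ≤ a, ‖x s‖ ≤ A)
    (hr : ∀ t ∈ Ico a b, Tendsto x (nhdsWithin t (Ici t)) (nhds (x t)))
    (hint : ∀ t ∈ Icc a b, x t = x a + ∫ s in a..t, F s)
    (hF : ∀ s ∈ Ico a b, ‖F s‖ ≤ C + L * (‖x s‖ + ‖x (s - σ s)‖))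
    (hσ : ∀ s ∈ Ico a b, 0 ≤ σ s) :
    ∀ t ∈ Icc a b, ‖x t‖ ≤ (A + 1) * Real.exp ((C + 2 * L + 1) * (t - a)) := by
  set B := C + 2 * L + 1 with hB
  have hB0 : 0 < B := by positivity
  set W : ℝ → ℝ := fun t => (A + 1) * Real.exp (B * (t - a)) with hW
  have hWmono : Monotone W := fun s t hst => by
    change (A + 1) * Real.exp (B * (s - a)) ≤ (A + 1) * Real.exp (B * (t - a))
    gcongr
  have hWa : W a = A + 1 := by simp [hW]
  have hWcont : Continuous W := by fun_prop
  have hWint : ∀ t, ∫ s in a..t, B * W s = W t - W a := fun t => by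
    refine intervalIntegral.integral_eq_sub_of_hasDerivAt (fun s _ => ?_)
      ((hWcont.const_smul B).intervalIntegrable _ _)
    have h1 : HasDerivAt (fun s => B * (s - a)) (B * 1) s :=
      ((hasDerivAt_id s).sub_const a).const_mul B
    refine (h1.exp.const_mul (A + 1)).congr_deriv ?_
    change _ = B * ((A + 1) * Real.exp (B * (s - a)))
    ring
  have hstrict : ∀ t ∈ Icc a b, (∀ s ∈ Ico a t, ‖x s‖ ≤ W s) → ‖x t‖ < W t := by
    intro t ht hs
    have hpt : ∀ s, s < t → ‖x s‖ ≤ max A (W s) := fun s hst => by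
      rcases le_total s a with h | h
      · exact (hx s h).trans (le_max_left _ _)
      · exact (hs s ⟨h, hst⟩).trans (le_max_right _ _)
    have hFle : ∀ s ∈ Ico a t, ‖F s‖ ≤ B * W s := fun s hst => by
      have hsb : s ∈ Ico a b := ⟨hst.1, hst.2.trans_le ht.2⟩
      have hAW : A + 1 ≤ W s := hWa ▸ hWmono hst.1
      have h1 := hs s hst
      have h2 : ‖x (s - σ s)‖ ≤ W s := by
        refine (hpt _ (by linarith [hσ s hsb, hst.2])).trans (max_le (by linarith) ?_)
        exact hWmono (by linarith [hσ s hsb])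
      calc ‖F s‖ ≤ C + L * (‖x s‖ + ‖x (s - σ s)‖) := hF s hsb
        _ ≤ C * W s + L * (W s + W s) := by
          have : C ≤ C * W s := le_mul_of_one_le_right hC (by linarith)
          gcongr
        _ ≤ B * W s := by
          rw [hB]; nlinarith
    have h3 : ‖∫ s in a..t, F s‖ ≤ ∫ s in a..t, B * W s := by
      refine intervalIntegral.norm_integral_le_of_norm_le ht.1 ?_
        ((hWcont.const_smul B).intervalIntegrable _ _)
      filter_upwards [volume.ae_ne t] with s hst hs'
      exact hFle s ⟨hs'.1.le, lt_of_le_of_ne hs'.2 hst⟩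
    rw [hWint, hWa] at h3
    rw [hint t ht]
    calc _ ≤ ‖x a‖ + ‖∫ s in a..t, F s‖ := norm_add_le _ _
      _ < W t := by linarith [hx a le_rfl]
  refine forall_mem_Icc_of_left_of_right (fun t ht hs => (hstrict t ht hs).le) fun t ht hs => ?_
  have hlt := hstrict t ⟨ht.1, ht.2.le⟩ fun s hs' => hs s ⟨hs'.1, hs'.2.le⟩
  have hev : ∀ᶠ s in nhdsWithin t (Ici t), ‖x s‖ < W s :=
    (hr t ht).norm.eventually_lt (hWcont.tendsto t |>.mono_left nhdsWithin_le_nhds) hlt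
  obtain ⟨u, hu, hsub⟩ := mem_nhdsGE_iff_exists_Ico_subset.1 hev
  exact ⟨u, hu, fun s hs' => le_of_lt (hsub ⟨hs'.1.le, hs'.2⟩)⟩

/-- The hypotheses on the impulsive initial value problem, with all Lipschitz and growth constants
global, and with `f` and `g` continuous on the whole space. -/
structure GlobalIIVP (n K : ℕ) (T lam : ℝ) (f : ℝ → (Fin n → ℝ) → (Fin n → ℝ) → (Fin n → ℝ))
    (g : ℝ → (Fin n → ℝ) → ℝ → ℝ) (Imp : ℕ → (Fin n → ℝ) → (Fin n → ℝ))
    (φ : ℝ → (Fin n → ℝ)) (tm tI : ℕ → ℝ) (L1 L2 L3 C : ℝ) : Prop where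
  T_pos : 0 < T
  lam_pos : 0 < lam
  L1_nonneg : 0 ≤ L1
  L2_nonneg : 0 ≤ L2
  L3_nonneg : 0 ≤ L3
  C_nonneg : 0 ≤ C
  f_cont : Continuous fun p : ℝ × (Fin n → ℝ) × (Fin n → ℝ) => f p.1 p.2.1 p.2.2
  f_lip : ∀ t u ub v vb, ‖f t u v - f t ub vb‖ ≤ L1 * (‖u - ub‖ + ‖v - vb‖)
  f_zero : ∀ t, ‖f t 0 0‖ ≤ C
  g_cont : Continuous fun p : ℝ × (Fin n → ℝ) × ℝ => g p.1 p.2.1 p.2.2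
  g_lip : ∀ t u ub w wb, |g t u w - g t ub wb| ≤ L2 * (‖u - ub‖ + |w - wb|)
  g_zero : ∀ t, |g t 0 0| ≤ C
  g_pos : ∀ t u, 0 < g t u 0
  g_lt_one : ∀ t u w, 0 ≤ w → g t u w < 1
  imp_lip : ∀ k, 1 ≤ k → k ≤ K → ∀ u ub, ‖Imp k u - Imp k ub‖ ≤ L3 * ‖u - ub‖
  imp_zero : ∀ k, 1 ≤ k → k ≤ K → ‖Imp k 0‖ ≤ C
  hist : AssumptionA4 n φ tm
  hist_le : ∀ s ≤ 0, ‖φ s‖ ≤ C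
  tI_zero : tI 0 = 0
  tI_last : tI (K + 1) = T
  tI_mono : ∀ k ≤ K, tI k < tI (k + 1)

section

variable {n K : ℕ} {T lam : ℝ} {f : ℝ → (Fin n → ℝ) → (Fin n → ℝ) → (Fin n → ℝ)}
  {g : ℝ → (Fin n → ℝ) → ℝ → ℝ} {Imp : ℕ → (Fin n → ℝ) → (Fin n → ℝ)} {φ : ℝ → (Fin n → ℝ)}
  {tm tI : ℕ → ℝ} {L1 L2 L3 C : ℝ}

namespace GlobalIIVP

theorem tI_lt (H : GlobalIIVP n K T lam f g Imp φ tm tI L1 L2 L3 C) :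
    ∀ j ≤ K + 1, ∀ k < j, tI k < tI j := by
  intro j
  induction j with
  | zero => intro _ k hk; omega
  | succ j ih =>
    intro hj k hk
    have h1 := H.tI_mono j (by omega)
    rcases Nat.lt_succ_iff_lt_or_eq.1 hk with h | h
    · exact (ih (by omega) k h).trans h1
    · exact h ▸ h1

theorem tI_pos (H : GlobalIIVP n K T lam f g Imp φ tm tI L1 L2 L3 C) {k : ℕ} (hk : 1 ≤ k)
    (hkK : k ≤ K) : 0 < tI k :=
  H.tI_zero ▸ H.tI_lt k (by omega) 0 hk

theorem norm_f_le (H : GlobalIIVP n K T lam f g Imp φ tm tI L1 L2 L3 C) (t : ℝ)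
    (u v : Fin n → ℝ) : ‖f t u v‖ ≤ C + L1 * (‖u‖ + ‖v‖) := by
  have h1 := H.f_lip t u 0 v 0
  rw [sub_zero, sub_zero] at h1
  calc ‖f t u v‖ = ‖f t 0 0 + (f t u v - f t 0 0)‖ := by rw [add_sub_cancel]
    _ ≤ _ := (norm_add_le _ _).trans (add_le_add (H.f_zero t) h1)

theorem abs_g_le (H : GlobalIIVP n K T lam f g Imp φ tm tI L1 L2 L3 C) (t : ℝ)
    (u : Fin n → ℝ) (w : ℝ) : |g t u w| ≤ C + L2 * (‖u‖ + |w|) := by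
  have h1 := H.g_lip t u 0 w 0
  rw [sub_zero, sub_zero] at h1
  calc |g t u w| = |g t 0 0 + (g t u w - g t 0 0)| := by rw [add_sub_cancel]
    _ ≤ _ := (abs_add_le _ _).trans (add_le_add (H.g_zero t) h1)

theorem norm_imp_le (H : GlobalIIVP n K T lam f g Imp φ tm tI L1 L2 L3 C) {k : ℕ} (hk : 1 ≤ k)
    (hkK : k ≤ K) (u : Fin n → ℝ) : ‖Imp k u‖ ≤ C + L3 * ‖u‖ := by
  have h1 := H.imp_lip k hk hkK u 0
  rw [sub_zero] at h1
  calc ‖Imp k u‖ = ‖Imp k 0 + (Imp k u - Imp k 0)‖ := by rw [add_sub_cancel]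
    _ ≤ _ := (norm_add_le _ _).trans (add_le_add (H.imp_zero k hk hkK) h1)

theorem exists_hist_piece (H : GlobalIIVP n K T lam f g Imp φ tm tI L1 L2 L3 C) {t : ℝ}
    (ht : t < 0) : ∃ k, t ∈ Ico (tm (k + 1)) (tm k) := by
  obtain ⟨h0, -, hbot, -⟩ := H.hist
  have hex : ∃ k, tm k ≤ t := (hbot.eventually_le_atBot t).exists
  classical
  have hne : Nat.find hex ≠ 0 := fun h => by
    have := Nat.find_spec hex
    rw [h, h0] at this
    linarith
  obtain ⟨k, hk⟩ := Nat.exists_eq_succ_of_ne_zero hne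
  exact ⟨k, by simpa only [hk] using Nat.find_spec hex, not_le.1 (Nat.find_min hex (by omega))⟩

theorem exists_hist_lipschitz_right (H : GlobalIIVP n K T lam f g Imp φ tm tI L1 L2 L3 C)
    {p : ℝ} (hp : p < 0) : ∃ ε > 0, p + ε < 0 ∧ ∃ L, 0 ≤ L ∧ ∀ s ∈ Icc p (p + ε),
      ∀ r ∈ Icc p (p + ε), ‖φ s - φ r‖ ≤ L * |s - r| := by
  obtain ⟨k, hk⟩ := H.exists_hist_piece hp
  obtain ⟨h0, hanti, -, -, -, hlip⟩ := H.hist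
  have hk0 : tm k ≤ 0 := h0 ▸ hanti.antitone (Nat.zero_le k)
  obtain ⟨L, hL, hLip⟩ := hlip (-p) (by linarith)
  refine ⟨(tm k - p) / 2, by linarith [hk.2], by linarith [hk.2], L, hL, fun s hs r hr => ?_⟩
  have hmem : ∀ q ∈ Icc p (p + (tm k - p) / 2), q ∈ Ico (tm (k + 1)) (tm k) ∩ Icc (- -p) 0 :=
    fun q hq => ⟨⟨hk.1.trans hq.1, by linarith [hk.2, hq.2]⟩, by linarith [hq.1],
      by linarith [hk.2, hq.2]⟩
  exact hLip k s (hmem s hs) r (hmem r hr)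

theorem exists_hist_lipschitz (H : GlobalIIVP n K T lam f g Imp φ tm tI L1 L2 L3 C) :
    ∃ L, 0 ≤ L ∧ ∀ s ∈ Ico (-lam) 0, ∀ r ∈ Ico (-lam) 0, s ≤ r → (∀ k, tm k ∉ Ioc s r) →
      ‖φ r - φ s‖ ≤ L * |r - s| := by
  obtain ⟨L, hL, hLip⟩ := H.hist.2.2.2.2.2 lam H.lam_pos
  refine ⟨L, hL, fun s hs r hr hsr hk => ?_⟩
  obtain ⟨k, hkr⟩ := H.exists_hist_piece hr.2
  have hks : tm (k + 1) ≤ s := not_lt.1 fun h => hk (k + 1) ⟨h, hkr.1⟩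
  exact hLip k r ⟨hkr, hr.1, hr.2.le⟩ s ⟨⟨hks, hsr.trans_lt hkr.2⟩, hs.1, hs.2.le⟩

end GlobalIIVP

/-- The moments in a finite family are isolated. -/
theorem exists_pos_forall_mem_Ioo_eq (K : ℕ) (tI : ℕ → ℝ) (t : ℝ) :
    ∃ ε > 0, ∀ k, 1 ≤ k → k ≤ K → tI k ∈ Ioo (t - ε) (t + ε) → tI k = t := by
  have hfin : ((tI '' Icc 1 K) \ {t}).Finite := ((finite_Icc 1 K).image tI).sdiff
  have hnhds : ((tI '' Icc 1 K) \ {t})ᶜ ∈ nhds t :=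
    hfin.isClosed.isOpen_compl.mem_nhds (by simp)
  obtain ⟨ε, hε, hsub⟩ := Metric.mem_nhds_iff.1 hnhds
  refine ⟨ε, hε, fun k hk hkK hmem => ?_⟩
  by_contra hne
  exact hsub (Real.ball_eq_Ioo t ε ▸ hmem) ⟨⟨k, ⟨hk, hkK⟩, rfl⟩, hne⟩

namespace IsIIVPSol

variable {β : ℝ} {x : ℝ → (Fin n → ℝ)} {τ : ℝ → ℝ}

theorem x_init (h : IsIIVPSol n K f g Imp φ lam tI β x τ) : ∀ t ≤ 0, x t = φ t := h.1

theorem tau_init (h : IsIIVPSol n K f g Imp φ lam tI β x τ) : ∀ t ≤ 0, τ t = lam := h.2.1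

theorem tau_cont (h : IsIIVPSol n K f g Imp φ lam tI β x τ) : ContinuousOn τ (Icc 0 β) := h.2.2.1

theorem tau_eq (h : IsIIVPSol n K f g Imp φ lam tI β x τ) :
    ∀ t ∈ Icc (0 : ℝ) β, τ t = lam + ∫ s in (0 : ℝ)..t, g s (x s) (τ s) := h.2.2.2.1

theorem x_right (h : IsIIVPSol n K f g Imp φ lam tI β x τ) :
    ∀ t ∈ Icc (0 : ℝ) β, Tendsto x (nhdsWithin t (Ici t)) (nhds (x t)) := h.2.2.2.2.1

theorem x_jump (h : IsIIVPSol n K f g Imp φ lam tI β x τ) :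
    ∀ k, 1 ≤ k → k ≤ K → tI k ≤ β →
      ∃ ξ, Tendsto x (nhdsWithin (tI k) (Iio (tI k))) (nhds ξ) ∧ x (tI k) = ξ + Imp k ξ :=
  h.2.2.2.2.2.1

theorem x_eq (h : IsIIVPSol n K f g Imp φ lam tI β x τ) :
    ∀ a b : ℝ, 0 ≤ a → a ≤ b → b ≤ β → (∀ k, 1 ≤ k → k ≤ K → tI k ∉ Ioc a b) →
      x b = x a + ∫ s in a..b, f s (x s) (x (s - τ s)) := h.2.2.2.2.2.2

theorem mono (h : IsIIVPSol n K f g Imp φ lam tI β x τ) {β' : ℝ} (hβ : β' ≤ β) :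
    IsIIVPSol n K f g Imp φ lam tI β' x τ :=
  ⟨h.x_init, h.tau_init, h.tau_cont.mono (Icc_subset_Icc_right hβ),
    fun t ht => h.tau_eq t ⟨ht.1, ht.2.trans hβ⟩, fun t ht => h.x_right t ⟨ht.1, ht.2.trans hβ⟩,
    fun k hk hkK hkβ => h.x_jump k hk hkK (hkβ.trans hβ),
    fun a b ha hab hb => h.x_eq a b ha hab (hb.trans hβ)⟩

theorem congr_of_lt (h : IsIIVPSol n K f g Imp φ lam tI β x τ) (hpos : ∀ t ∈ Icc 0 β, 0 < τ t)
    {x' : ℝ → (Fin n → ℝ)} {τ' : ℝ → ℝ} (hx : ∀ t ≤ β, x' t = x t) (hτ : ∀ t ≤ β, τ' t = τ t)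
    {β' : ℝ} (hβ : β' < β) (hβ0 : 0 ≤ β') : IsIIVPSol n K f g Imp φ lam tI β' x' τ' := by
  refine ⟨fun t ht => (hx t (by linarith)).trans (h.x_init t ht),
    fun t ht => (hτ t (by linarith)).trans (h.tau_init t ht),
    (h.tau_cont.mono (Icc_subset_Icc_right hβ.le)).congr fun t ht => hτ t (ht.2.trans hβ.le),
    fun t ht => ?_, fun t ht => ?_, fun k hk hkK hkβ => ?_, fun a b ha hab hb hk => ?_⟩
  · rw [hτ t (ht.2.trans hβ.le), h.tau_eq t ⟨ht.1, ht.2.trans hβ.le⟩]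
    congr 1
    refine intervalIntegral.integral_congr_Ioo_of_le ht.1 fun s hs => ?_
    have hsβ : s ≤ β := by linarith [hs.2, ht.2]
    simp only [hx s hsβ, hτ s hsβ]
  · rw [hx t (ht.2.trans hβ.le)]
    refine (h.x_right t ⟨ht.1, ht.2.trans hβ.le⟩).congr' ?_
    filter_upwards [nhdsWithin_le_nhds (Iio_mem_nhds (ht.2.trans_lt hβ))] with s hs
    exact (hx s (le_of_lt hs)).symm
  · obtain ⟨ξ, hξ, hjump⟩ := h.x_jump k hk hkK (hkβ.trans hβ.le)
    refine ⟨ξ, hξ.congr' ?_, (hx _ (hkβ.trans hβ.le)).trans hjump⟩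
    filter_upwards [self_mem_nhdsWithin] with s hs
    exact (hx s ((le_of_lt hs).trans (hkβ.trans hβ.le))).symm
  · rw [hx b (hb.trans hβ.le), hx a (hab.trans (hb.trans hβ.le)),
      h.x_eq a b ha hab (hb.trans hβ.le) hk]
    congr 1
    refine intervalIntegral.integral_congr_Ioo_of_le hab fun s hs => ?_
    have hsβ : s ≤ β := by linarith [hs.2]
    have hd : s - τ s ≤ β := by linarith [hpos s ⟨ha.trans hs.1.le, hsβ⟩]
    simp only [hx s hsβ, hτ s hsβ, hx _ hd]

end IsIIVPSol

end

section

variable {n K : ℕ} {T lam : ℝ} {f : ℝ → (Fin n → ℝ) → (Fin n → ℝ) → (Fin n → ℝ)}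
  {g : ℝ → (Fin n → ℝ) → ℝ → ℝ} {Imp : ℕ → (Fin n → ℝ) → (Fin n → ℝ)} {φ : ℝ → (Fin n → ℝ)}
  {tm tI : ℕ → ℝ} {L1 L2 L3 C : ℝ}

namespace GlobalIIVP

/-- The Grönwall bound on an impulse-free interval `(a, t]`. -/
theorem norm_le_exp (H : GlobalIIVP n K T lam f g Imp φ tm tI L1 L2 L3 C) {β : ℝ}
    {x : ℝ → (Fin n → ℝ)} {τ : ℝ → ℝ} (hβT : β ≤ T)
    (h : IsIIVPSol n K f g Imp φ lam tI β x τ) {a t A : ℝ} (ha : 0 ≤ a) (hat : a ≤ t) (ht : t ≤ β)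
    (hτ : ∀ s ∈ Ico 0 t, 0 ≤ τ s) (hA : 0 ≤ A) (hx : ∀ s ≤ a, ‖x s‖ ≤ A)
    (hk : ∀ k, 1 ≤ k → k ≤ K → tI k ∉ Ioc a t) :
    ‖x t‖ ≤ (A + 1) * Real.exp ((C + 2 * L1 + 1) * T) := by
  have hC := H.C_nonneg
  have hL := H.L1_nonneg
  have h1 := norm_le_exp_of_eq_add_integral (x := x) (σ := τ) (a := a) (b := t) (A := A)
    (F := fun s => f s (x s) (x (s - τ s))) hA hC hL hx
    (fun s hs => h.x_right s ⟨ha.trans hs.1, hs.2.le.trans ht⟩)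
    (fun s hs => h.x_eq a s ha hs.1 (hs.2.trans ht)
      fun k hk1 hkK hmem => hk k hk1 hkK ⟨hmem.1, hmem.2.trans hs.2⟩)
    (fun s _ => H.norm_f_le s _ _) (fun s hs => hτ s ⟨ha.trans hs.1, hs.2⟩) t ⟨hat, le_rfl⟩
  refine h1.trans ?_
  gcongr
  linarith

theorem exists_norm_le_of_tau_nonneg (H : GlobalIIVP n K T lam f g Imp φ tm tI L1 L2 L3 C) :
    ∃ M, 0 ≤ M ∧ ∀ (β : ℝ) (x : ℝ → (Fin n → ℝ)) (τ : ℝ → ℝ), β ≤ T →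
      IsIIVPSol n K f g Imp φ lam tI β x τ → ∀ t ≤ β, (∀ s ∈ Ico 0 t, 0 ≤ τ s) → ‖x t‖ ≤ M := by
  have hC := H.C_nonneg
  have hL := H.L1_nonneg
  have hT := H.T_pos
  have hexp : 1 ≤ Real.exp ((C + 2 * L1 + 1) * T) := Real.one_le_exp (by positivity)
  have key : ∀ k ≤ K, ∃ A, 0 ≤ A ∧ ∀ (β : ℝ) (x : ℝ → (Fin n → ℝ)) (τ : ℝ → ℝ), β ≤ T →
      IsIIVPSol n K f g Imp φ lam tI β x τ → ∀ t ≤ β, (∀ s ∈ Ico 0 t, 0 ≤ τ s) →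
      (∀ j, k < j → j ≤ K → t < tI j) → ‖x t‖ ≤ A := by
    intro k
    induction k with
    | zero =>
      intro _
      refine ⟨(C + 1) * Real.exp ((C + 2 * L1 + 1) * T), by positivity,
        fun β x τ hβ h t ht hτ hj => ?_⟩
      have hinit : ∀ s ≤ 0, ‖x s‖ ≤ C := fun s hs => h.x_init s hs ▸ H.hist_le s hs
      rcases le_total t 0 with h0 | h0
      · refine (hinit t h0).trans ?_
        nlinarith
      · exact H.norm_le_exp hβ h le_rfl h0 ht hτ hC hinit
          fun k hk hkK hmem => absurd hmem.2 (not_le.2 (hj k (by omega) hkK))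
    | succ k ih =>
      intro hkK
      obtain ⟨A, hA, hbound⟩ := ih (by omega)
      have hL3 := H.L3_nonneg
      refine ⟨(A + (C + L3 * A) + 1) * Real.exp ((C + 2 * L1 + 1) * T), by positivity,
        fun β x τ hβ h t ht hτ hj => ?_⟩
      have hle : ∀ j, k < j → j ≤ K → tI (k + 1) ≤ tI j := fun j hkj hjK => by
        rcases (Nat.succ_le_of_lt hkj).lt_or_eq with h1 | h1
        · exact (H.tI_lt j (by omega) _ h1).le
        · exact le_of_eq (congrArg tI h1)
      have hLA : 0 ≤ L3 * A := by positivity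
      rcases lt_or_ge t (tI (k + 1)) with hlt | hge
      · have := hbound β x τ hβ h t ht hτ fun j hkj hjK => hlt.trans_le (hle j hkj hjK)
        nlinarith
      · have hpos := H.tI_pos (k := k + 1) (by omega) hkK
        have hprev : ∀ s < tI (k + 1), ‖x s‖ ≤ A := fun s hs =>
          hbound β x τ hβ h s (by linarith) (fun r hr => hτ r ⟨hr.1, by linarith [hr.2]⟩)
            fun j hkj hjK => hs.trans_le (hle j hkj hjK)
        obtain ⟨ξ, hξ, hjump⟩ := h.x_jump (k + 1) (by omega) hkK (hge.trans ht)
        have hξA : ‖ξ‖ ≤ A := by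
          refine le_of_tendsto hξ.norm ?_
          filter_upwards [self_mem_nhdsWithin] with s hs
          exact hprev s hs
        refine H.norm_le_exp hβ h hpos.le hge ht hτ (by positivity) (fun s hs => ?_)
          fun j hj1 hjK hmem => ?_
        · rcases hs.lt_or_eq with h1 | h1
          · linarith [hprev s h1]
          · rw [h1, hjump]
            refine (norm_add_le _ _).trans (add_le_add hξA ?_)
            exact (H.norm_imp_le (by omega) hkK ξ).trans (by gcongr)
        · rcases Nat.lt_or_ge (k + 1) j with h1 | h1
          · exact absurd hmem.2 (not_le.2 (hj j h1 hjK))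
          · rcases h1.lt_or_eq with h2 | h2
            · exact absurd hmem.1 (not_lt.2 (H.tI_lt (k + 1) (by omega) j h2).le)
            · exact absurd hmem.1 (h2 ▸ lt_irrefl _)
  obtain ⟨A, hA, hbound⟩ := key K le_rfl
  exact ⟨A, hA, fun β x τ hβ h t ht hτ => hbound β x τ hβ h t ht hτ fun j h1 h2 => by omega⟩

theorem tau_pos (H : GlobalIIVP n K T lam f g Imp φ tm tI L1 L2 L3 C) {β : ℝ}
    {x : ℝ → (Fin n → ℝ)} {τ : ℝ → ℝ} (hβT : β ≤ T)
    (h : IsIIVPSol n K f g Imp φ lam tI β x τ) : ∀ t ∈ Icc 0 β, 0 < τ t := by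
  obtain ⟨M, hM, hbound⟩ := H.exists_norm_le_of_tau_nonneg
  have hL2 := H.L2_nonneg
  obtain ⟨m, hm, hgm⟩ : ∃ m > 0, ∀ s ∈ Icc 0 T, ∀ u : Fin n → ℝ, ‖u‖ ≤ M → m ≤ g s u 0 := by
    have hcomp : IsCompact (Icc 0 T ×ˢ Metric.closedBall (0 : Fin n → ℝ) M) :=
      isCompact_Icc.prod (isCompact_closedBall _ _)
    obtain ⟨p, hp, hmin⟩ := hcomp.exists_isMinOn ⟨(0, 0), ⟨le_rfl, H.T_pos.le⟩, by simpa⟩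
      (f := fun p : ℝ × (Fin n → ℝ) => g p.1 p.2 0)
      (H.g_cont.comp (continuous_fst.prodMk (continuous_snd.prodMk continuous_const))).continuousOn
    exact ⟨_, H.g_pos p.1 p.2, fun s hs u hu => hmin (show (s, u) ∈ _ from ⟨hs, by simpa using hu⟩)⟩
  refine forall_mem_Icc_of_left_of_right (fun t ht hs => ?_) fun t ht hs => ?_
  · by_contra hneg
    have hteq := h.tau_eq t ht
    by_cases hint : IntervalIntegrable (fun s => g s (x s) (τ s)) volume 0 t
    · have ht0 : 0 < t := ht.1.lt_of_ne fun h0 => by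
        rw [← h0, h.tau_init 0 le_rfl] at hneg
        exact hneg H.lam_pos
      have hcont : Tendsto τ (nhdsWithin t (Ico 0 t)) (nhds (τ t)) :=
        (h.tau_cont t ht).mono fun s hs => ⟨hs.1, hs.2.le.trans ht.2⟩
      rw [nhdsWithin_Ico_eq_nhdsLT ht0] at hcont
      have hev : ∀ᶠ s in nhdsWithin t (Iio t), τ s < m / (L2 + 1) :=
        hcont.eventually_lt_const ((not_lt.1 hneg).trans_lt (by positivity))
      obtain ⟨r, hr, hrs⟩ := (mem_nhdsLT_iff_exists_Ioo_subset' ht0).1 hev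
      set q := max 0 ((r + t) / 2) with hq
      have hr' : r < t := hr
      have hq0 : 0 ≤ q := le_max_left _ _
      have hqt : q < t := max_lt ht0 (by linarith)
      have hrq : r < q := lt_of_lt_of_le (by linarith) (le_max_right _ _)
      have hGnonneg : ∀ s ∈ Ioo q t, 0 ≤ g s (x s) (τ s) := fun s hs' => by
        have hs0 : 0 ≤ s := hq0.trans hs'.1.le
        have h1 : 0 < τ s := hs s ⟨hs0, hs'.2⟩
        have h2 : τ s < m / (L2 + 1) := hrs ⟨hrq.trans hs'.1, hs'.2⟩
        have h3 := hgm s ⟨hs0, by linarith [hs'.2, ht.2]⟩ (x s)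
          (hbound β x τ hβT h s (hs'.2.le.trans ht.2)
            fun r hr => (hs r ⟨hr.1, hr.2.trans hs'.2⟩).le)
        have h4 := H.g_lip s (x s) (x s) (τ s) 0
        rw [sub_self, norm_zero, zero_add, sub_zero, abs_of_pos h1] at h4
        have h5 := (abs_le.1 h4).1
        rw [lt_div_iff₀ (by positivity)] at h2
        nlinarith
      have hqmem : q ∈ uIcc 0 t := by rw [uIcc_of_le ht0.le]; exact ⟨hq0, hqt.le⟩
      have hI1 := hint.mono_set (uIcc_subset_uIcc_left hqmem)
      have hI2 := hint.mono_set (uIcc_subset_uIcc_right hqmem)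
      have hqeq := h.tau_eq q ⟨hq0, hqt.le.trans ht.2⟩
      rw [← intervalIntegral.integral_add_adjacent_intervals hI1 hI2, ← add_assoc, ← hqeq] at hteq
      have hnn : 0 ≤ ∫ s in q..t, g s (x s) (τ s) := by
        refine intervalIntegral.integral_nonneg_of_ae_restrict hqt.le ?_
        rw [← restrict_Ioo_eq_restrict_Icc]
        filter_upwards [self_mem_ae_restrict measurableSet_Ioo] with s hs
        exact hGnonneg s hs
      have := hs q ⟨hq0, hqt⟩
      linarith
    · rw [intervalIntegral.integral_undef hint, add_zero] at hteq
      exact hneg (hteq ▸ H.lam_pos)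
  · have hpos := hs t ⟨ht.1, le_rfl⟩
    have hev : ∀ᶠ s in nhdsWithin t (Icc t β), 0 < τ s :=
      ((h.tau_cont t ⟨ht.1, ht.2.le⟩).mono (Icc_subset_Icc_left ht.1)).eventually_const_lt hpos
    rw [nhdsWithin_Icc_eq_nhdsGE ht.2] at hev
    obtain ⟨u, hu, hsub⟩ := mem_nhdsGE_iff_exists_Ico_subset.1 hev
    exact ⟨u, hu, fun s hs => hsub ⟨hs.1.le, hs.2⟩⟩

theorem x_tendsto_right (H : GlobalIIVP n K T lam f g Imp φ tm tI L1 L2 L3 C) {β : ℝ}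
    {x : ℝ → (Fin n → ℝ)} (hinit : ∀ t ≤ 0, x t = φ t)
    (hr : ∀ t ∈ Icc 0 β, Tendsto x (nhdsWithin t (Ici t)) (nhds (x t))) :
    ∀ t ≤ β, Tendsto x (nhdsWithin t (Ici t)) (nhds (x t)) := by
  intro t ht
  rcases le_or_gt 0 t with h0 | h0
  · exact hr t ⟨h0, ht⟩
  · obtain ⟨ε, hε, hneg, L, hL, hlip⟩ := H.exists_hist_lipschitz_right h0
    rw [tendsto_iff_norm_sub_tendsto_zero]
    have hlim : Tendsto (fun s => L * |s - t|) (nhdsWithin t (Ici t)) (nhds 0) := by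
      have : Continuous fun s => L * |s - t| := by fun_prop
      simpa using (this.tendsto t).mono_left nhdsWithin_le_nhds
    refine squeeze_zero' (Eventually.of_forall fun _ => norm_nonneg _) ?_ hlim
    filter_upwards [Icc_mem_nhdsGE (show t < t + ε by linarith)] with s hs
    rw [hinit s (by linarith [hs.2]), hinit t h0.le]
    exact hlip s hs t ⟨le_rfl, by linarith⟩

end GlobalIIVP

end

section

variable {n K : ℕ} {T lam : ℝ} {f : ℝ → (Fin n → ℝ) → (Fin n → ℝ) → (Fin n → ℝ)}
  {g : ℝ → (Fin n → ℝ) → ℝ → ℝ} {Imp : ℕ → (Fin n → ℝ) → (Fin n → ℝ)} {φ : ℝ → (Fin n → ℝ)}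
  {tm tI : ℕ → ℝ} {L1 L2 L3 C : ℝ}

/-- A bounded function agreeing on `[a, b]` with a measurable one is interval integrable. -/
theorem intervalIntegrable_of_eqOn_measurable {E : Type*} [NormedAddCommGroup E]
    [SecondCountableTopology E] [MeasurableSpace E] [BorelSpace E] {F G : ℝ → E} {a b R : ℝ}
    (hab : a ≤ b) (hG : Measurable G) (hFG : EqOn F G (Icc a b)) (hR : ∀ s ∈ Icc a b, ‖F s‖ ≤ R) :
    IntervalIntegrable F volume a b := by
  rw [intervalIntegrable_iff_integrableOn_Icc_of_le hab]
  refine IntegrableOn.congr_fun (f := G) ?_ hFG.symm measurableSet_Icc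
  refine Measure.integrableOn_of_bounded (M := R) measure_Icc_lt_top.ne hG.aestronglyMeasurable ?_
  filter_upwards [self_mem_ae_restrict measurableSet_Icc] with s hs
  exact hFG hs ▸ hR s hs

namespace GlobalIIVP

/-- Along a bounded right-continuous trajectory, the two right-hand sides are integrable. -/
theorem intervalIntegrable_rhs (H : GlobalIIVP n K T lam f g Imp φ tm tI L1 L2 L3 C) {β M : ℝ}
    {x : ℝ → (Fin n → ℝ)} {τ : ℝ → ℝ} (hβ : 0 ≤ β)
    (hr : ∀ t ≤ β, Tendsto x (nhdsWithin t (Ici t)) (nhds (x t)))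
    (hM : ∀ t ≤ β, ‖x t‖ ≤ M) (hτ : ContinuousOn τ (Icc 0 β)) (hpos : ∀ t ∈ Icc 0 β, 0 ≤ τ t) :
    IntervalIntegrable (fun s => f s (x s) (x (s - τ s))) volume 0 β ∧
      IntervalIntegrable (fun s => g s (x s) (τ s)) volume 0 β := by
  have hL1 := H.L1_nonneg
  have hL2 := H.L2_nonneg
  set X : ℝ → (Fin n → ℝ) := fun t => x (min t β) with hX
  have hXm : Measurable X := by
    refine measurable_of_forall_tendsto_nhdsGE fun t => ?_
    refine (hr (min t β) (min_le_right _ _)).comp (tendsto_nhdsWithin_iff.2 ⟨?_, ?_⟩)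
    · exact ((by fun_prop : Continuous fun s : ℝ => min s β).tendsto t).mono_left
        nhdsWithin_le_nhds
    · filter_upwards [self_mem_nhdsWithin] with s hs
      exact min_le_min_right β hs
  set σ : ℝ → ℝ := IccExtend hβ ((Icc 0 β).domRestrict τ) with hσdef
  have hσ : Continuous σ := (continuousOn_iff_continuous_domRestrict.1 hτ).Icc_extend'
  have hσeq : ∀ s ∈ Icc 0 β, σ s = τ s := fun s hs => IccExtend_of_mem _ _ hs
  have hXeq : ∀ s ≤ β, X s = x s := fun s hs => by simp only [hX, min_eq_left hs]
  obtain ⟨R, hR⟩ := isCompact_Icc.exists_bound_of_continuousOn hτ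
  constructor
  · refine intervalIntegrable_of_eqOn_measurable (G := fun s => f s (X s) (X (s - σ s)))
      (R := C + L1 * (M + M)) hβ ?_ (fun s hs => ?_) fun s hs => ?_
    · exact H.f_cont.measurable.comp (measurable_id.prodMk
        (hXm.prodMk (hXm.comp (measurable_id.sub hσ.measurable))))
    · have hd : s - τ s ≤ β := by linarith [hpos s hs, hs.2]
      simp only [hσeq s hs, hXeq s hs.2, hXeq _ hd]
    · refine (H.norm_f_le s _ _).trans ?_
      have h1 := hM s hs.2
      have h2 := hM (s - τ s) (by linarith [hpos s hs, hs.2])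
      gcongr
  · refine intervalIntegrable_of_eqOn_measurable (G := fun s => g s (X s) (σ s))
      (R := C + L2 * (M + R)) hβ ?_ (fun s hs => ?_) fun s hs => ?_
    · exact H.g_cont.measurable.comp (measurable_id.prodMk (hXm.prodMk hσ.measurable))
    · simp only [hσeq s hs, hXeq s hs.2]
    · refine (H.abs_g_le s _ _).trans ?_
      have h1 := hM s hs.2
      have h2 : |τ s| ≤ R := hR s hs
      gcongr

theorem intervalIntegrable_of_isIIVPSol (H : GlobalIIVP n K T lam f g Imp φ tm tI L1 L2 L3 C)
    {β : ℝ} {x : ℝ → (Fin n → ℝ)} {τ : ℝ → ℝ} (hβT : β ≤ T)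
    (h : IsIIVPSol n K f g Imp φ lam tI β x τ) {a b : ℝ} (ha : 0 ≤ a) (hab : a ≤ b) (hb : b ≤ β) :
    IntervalIntegrable (fun s => f s (x s) (x (s - τ s))) volume a b ∧
      IntervalIntegrable (fun s => g s (x s) (τ s)) volume a b := by
  have hβ : 0 ≤ β := ha.trans (hab.trans hb)
  have hpos := H.tau_pos hβT h
  obtain ⟨M, hM, hbound⟩ := H.exists_norm_le_of_tau_nonneg
  have hsub : uIcc a b ⊆ uIcc 0 β := by
    rw [uIcc_of_le hab, uIcc_of_le hβ]
    exact Icc_subset_Icc ha hb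
  have h1 := H.intervalIntegrable_rhs hβ (H.x_tendsto_right h.x_init h.x_right)
    (fun t ht => hbound β x τ hβT h t ht fun s hs => (hpos s ⟨hs.1, hs.2.le.trans ht⟩).le)
    h.tau_cont fun t ht => (hpos t ht).le
  exact ⟨h1.1.mono_set hsub, h1.2.mono_set hsub⟩

theorem tau_eq_add_integral (H : GlobalIIVP n K T lam f g Imp φ tm tI L1 L2 L3 C)
    {β : ℝ} {x : ℝ → (Fin n → ℝ)} {τ : ℝ → ℝ} (hβT : β ≤ T)
    (h : IsIIVPSol n K f g Imp φ lam tI β x τ) {a b : ℝ} (ha : 0 ≤ a) (hab : a ≤ b) (hb : b ≤ β) :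
    τ b = τ a + ∫ s in a..b, g s (x s) (τ s) := by
  rw [h.tau_eq b ⟨ha.trans hab, hb⟩, h.tau_eq a ⟨ha, hab.trans hb⟩, add_assoc,
    intervalIntegral.integral_add_adjacent_intervals
      (H.intervalIntegrable_of_isIIVPSol hβT h le_rfl ha (hab.trans hb)).2
      (H.intervalIntegrable_of_isIIVPSol hβT h ha hab hb).2]

/-- The deviated time `t - τ t` is nondecreasing. -/
theorem tau_sub_le (H : GlobalIIVP n K T lam f g Imp φ tm tI L1 L2 L3 C)
    {β : ℝ} {x : ℝ → (Fin n → ℝ)} {τ : ℝ → ℝ} (hβT : β ≤ T)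
    (h : IsIIVPSol n K f g Imp φ lam tI β x τ) {a b : ℝ} (ha : 0 ≤ a) (hab : a ≤ b) (hb : b ≤ β) :
    τ b - τ a ≤ b - a := by
  rw [H.tau_eq_add_integral hβT h ha hab hb, add_sub_cancel_left]
  calc ∫ s in a..b, g s (x s) (τ s) ≤ ∫ _ in a..b, (1 : ℝ) :=
        intervalIntegral.integral_mono_on hab
          (H.intervalIntegrable_of_isIIVPSol hβT h ha hab hb).2 (by simp) fun s hs =>
          (H.g_lt_one s _ _ (H.tau_pos hβT h s ⟨ha.trans hs.1, hs.2.trans hb⟩).le).le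
    _ = b - a := by simp

/-- Bounds and Lipschitz constants valid for every solution on every subinterval. -/
theorem exists_uniform_bound (H : GlobalIIVP n K T lam f g Imp φ tm tI L1 L2 L3 C) :
    ∃ M, 0 ≤ M ∧ ∀ (β : ℝ) (x : ℝ → (Fin n → ℝ)) (τ : ℝ → ℝ), 0 ≤ β → β ≤ T →
      IsIIVPSol n K f g Imp φ lam tI β x τ →
      (∀ t ≤ β, ‖x t‖ ≤ M) ∧ (∀ t ≤ β, τ t ≤ M) ∧
      (∀ a b, 0 ≤ a → a ≤ b → b ≤ β → (∀ k, 1 ≤ k → k ≤ K → tI k ∉ Ioc a b) →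
        ‖x b - x a‖ ≤ M * (b - a)) ∧
      (∀ a b, 0 ≤ a → a ≤ b → b ≤ β → |τ b - τ a| ≤ M * (b - a)) := by
  obtain ⟨A, hA, hbound⟩ := H.exists_norm_le_of_tau_nonneg
  have hC := H.C_nonneg
  have hL1 := H.L1_nonneg
  have hL2 := H.L2_nonneg
  have hT := H.T_pos
  have hlam := H.lam_pos
  set Mf := C + L1 * (A + A) with hMf
  set Mg := C + L2 * (A + (lam + T)) with hMg
  have hMf0 : 0 ≤ Mf := by positivity
  have hMg0 : 0 ≤ Mg := by positivity
  refine ⟨A + (lam + T) + Mf + Mg, by positivity, fun β x τ hβ hβT h => ?_⟩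
  have hpos := H.tau_pos hβT h
  have hx : ∀ t ≤ β, ‖x t‖ ≤ A := fun t ht =>
    hbound β x τ hβT h t ht fun s hs => (hpos s ⟨hs.1, hs.2.le.trans ht⟩).le
  have hτ : ∀ t ≤ β, τ t ≤ lam + T := fun t ht => by
    rcases le_total t 0 with h0 | h0
    · rw [h.tau_init t h0]; linarith
    · have h1 := H.tau_sub_le hβT h le_rfl h0 ht
      rw [h.tau_init 0 le_rfl] at h1
      linarith
  refine ⟨fun t ht => by linarith [hx t ht], fun t ht => by linarith [hτ t ht],
    fun a b ha hab hb hk => ?_, fun a b ha hab hb => ?_⟩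
  · rw [h.x_eq a b ha hab hb hk, add_sub_cancel_left]
    have h1 : ‖∫ s in a..b, f s (x s) (x (s - τ s))‖ ≤ Mf * |b - a| := by
      refine intervalIntegral.norm_integral_le_of_norm_le_const fun s hs => ?_
      rw [uIoc_of_le hab] at hs
      have hs0 : s ≤ β := hs.2.trans hb
      have h2 := hx s hs0
      have h3 := hx (s - τ s) (by linarith [hpos s ⟨ha.trans hs.1.le, hs0⟩])
      exact (H.norm_f_le s _ _).trans (by rw [hMf]; gcongr)
    rw [abs_of_nonneg (sub_nonneg.2 hab)] at h1
    nlinarith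
  · rw [H.tau_eq_add_integral hβT h ha hab hb, add_sub_cancel_left]
    have h1 : ‖∫ s in a..b, g s (x s) (τ s)‖ ≤ Mg * |b - a| := by
      refine intervalIntegral.norm_integral_le_of_norm_le_const fun s hs => ?_
      rw [uIoc_of_le hab] at hs
      have hs0 : s ≤ β := hs.2.trans hb
      have h2 := hx s hs0
      have h3 : |τ s| ≤ lam + T := by
        rw [abs_of_pos (hpos s ⟨ha.trans hs.1.le, hs0⟩)]
        exact hτ s hs0
      exact (H.abs_g_le s _ _).trans (by rw [hMg]; gcongr)
    rw [abs_of_nonneg (sub_nonneg.2 hab), Real.norm_eq_abs] at h1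
    nlinarith

end GlobalIIVP

end

section

variable {n K : ℕ} {T lam : ℝ} {f : ℝ → (Fin n → ℝ) → (Fin n → ℝ) → (Fin n → ℝ)}
  {g : ℝ → (Fin n → ℝ) → ℝ → ℝ} {Imp : ℕ → (Fin n → ℝ) → (Fin n → ℝ)} {φ : ℝ → (Fin n → ℝ)}
  {tm tI : ℕ → ℝ} {L1 L2 L3 C : ℝ}

namespace GlobalIIVP

/-- Solutions are Lipschitz on a right neighbourhood of every point. -/
theorem exists_lipschitz_right (H : GlobalIIVP n K T lam f g Imp φ tm tI L1 L2 L3 C) {β : ℝ}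
    {x : ℝ → (Fin n → ℝ)} {τ : ℝ → ℝ} (hβ : 0 ≤ β) (hβT : β ≤ T)
    (h : IsIIVPSol n K f g Imp φ lam tI β x τ) {p : ℝ} (hp : p < β) :
    ∃ ε > 0, p + ε ≤ β ∧ ∃ L, 0 ≤ L ∧ ∀ s ∈ Icc p (p + ε), ∀ r ∈ Icc p (p + ε),
      ‖x s - x r‖ ≤ L * |s - r| := by
  rcases lt_or_ge p 0 with h0 | h0
  · obtain ⟨ε, hε, hneg, L, hL, hlip⟩ := H.exists_hist_lipschitz_right h0
    refine ⟨ε, hε, hneg.le.trans hβ, L, hL, fun s hs r hr => ?_⟩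
    rw [h.x_init s (hs.2.trans hneg.le), h.x_init r (hr.2.trans hneg.le)]
    exact hlip s hs r hr
  · obtain ⟨M, hM, hbound⟩ := H.exists_uniform_bound
    obtain ⟨-, -, hlip, -⟩ := hbound β x τ hβ hβT h
    obtain ⟨δ, hδ, hiso⟩ := exists_pos_forall_mem_Ioo_eq K tI p
    have hmin : min (δ / 2) (β - p) ≤ δ / 2 := min_le_left _ _
    have hmin' : min (δ / 2) (β - p) ≤ β - p := min_le_right _ _
    refine ⟨min (δ / 2) (β - p), lt_min (by linarith) (by linarith), by linarith, M, hM, ?_⟩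
    have key : ∀ s ∈ Icc p (p + min (δ / 2) (β - p)), ∀ r ∈ Icc p (p + min (δ / 2) (β - p)),
        s ≤ r → ‖x r - x s‖ ≤ M * (r - s) := fun s hs r hr hsr => by
      refine hlip s r (h0.trans hs.1) hsr (by linarith [hr.2]) fun k hk hkK hmem => ?_
      have := hiso k hk hkK ⟨by linarith [hmem.1, hs.1], by linarith [hmem.2, hr.2]⟩
      linarith [hmem.1, hs.1]
    intro s hs r hr
    rcases le_total s r with hsr | hsr
    · rw [norm_sub_rev, abs_sub_comm, abs_of_nonneg (sub_nonneg.2 hsr)]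
      exact key s hs r hr hsr
    · rw [abs_of_nonneg (sub_nonneg.2 hsr)]
      exact key r hr s hs hsr

/-- The deviated times of a solution stay close to the right of their initial value. -/
theorem exists_deviated_mem (H : GlobalIIVP n K T lam f g Imp φ tm tI L1 L2 L3 C) {β : ℝ}
    {x : ℝ → (Fin n → ℝ)} {τ : ℝ → ℝ} (hβT : β ≤ T)
    (h : IsIIVPSol n K f g Imp φ lam tI β x τ) {t ε : ℝ} (ht : t ∈ Ico 0 β) (hε : 0 < ε) :
    ∃ u > t, u ≤ β ∧ ∀ s ∈ Icc t u, s - τ s ∈ Icc (t - τ t) (t - τ t + ε) := by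
  have hev : ∀ᶠ s in nhdsWithin t (Icc t β), s - τ s < t - τ t + ε := by
    have hc : ContinuousWithinAt (fun s => s - τ s) (Icc t β) t :=
      continuousWithinAt_id.sub ((h.tau_cont t ⟨ht.1, ht.2.le⟩).mono (Icc_subset_Icc_left ht.1))
    exact hc.eventually_lt_const (by linarith)
  rw [nhdsWithin_Icc_eq_nhdsGE ht.2] at hev
  obtain ⟨u, hu, hsub⟩ := mem_nhdsGE_iff_exists_Icc_subset.1 hev
  refine ⟨min u β, lt_min hu ht.2, min_le_right _ _, fun s hs => ⟨?_, ?_⟩⟩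
  · linarith [H.tau_sub_le hβT h ht.1 hs.1 (hs.2.trans (min_le_right _ _))]
  · exact le_of_lt (hsub ⟨hs.1, hs.2.trans (min_le_left _ _)⟩)

/-- Two solutions that agree before `t` agree at `t`. -/
theorem eq_at_of_eq_before (H : GlobalIIVP n K T lam f g Imp φ tm tI L1 L2 L3 C) {β : ℝ}
    {x x' : ℝ → (Fin n → ℝ)} {τ τ' : ℝ → ℝ} (hβT : β ≤ T)
    (h : IsIIVPSol n K f g Imp φ lam tI β x τ) (h' : IsIIVPSol n K f g Imp φ lam tI β x' τ')
    {t : ℝ} (ht : t ∈ Icc 0 β) (heq : ∀ s ∈ Ico 0 t, x s = x' s ∧ τ s = τ' s) :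
    x t = x' t ∧ τ t = τ' t := by
  rcases ht.1.eq_or_lt with h0 | h0
  · subst h0
    exact ⟨(h.x_init 0 le_rfl).trans (h'.x_init 0 le_rfl).symm,
      (h.tau_init 0 le_rfl).trans (h'.tau_init 0 le_rfl).symm⟩
  have hxlt : ∀ s < t, x s = x' s := fun s hs => by
    rcases le_total s 0 with hs0 | hs0
    · rw [h.x_init s hs0, h'.x_init s hs0]
    · exact (heq s ⟨hs0, hs⟩).1
  constructor
  · by_cases hk : ∃ k, 1 ≤ k ∧ k ≤ K ∧ tI k = t
    · obtain ⟨k, hk1, hkK, rfl⟩ := hk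
      obtain ⟨ξ, hξ, hjump⟩ := h.x_jump k hk1 hkK ht.2
      obtain ⟨ξ', hξ', hjump'⟩ := h'.x_jump k hk1 hkK ht.2
      have : ξ = ξ' := tendsto_nhds_unique hξ <| hξ'.congr' <| by
        filter_upwards [self_mem_nhdsWithin] with s hs
        exact (hxlt s hs).symm
      rw [hjump, hjump', this]
    · obtain ⟨δ, hδ, hiso⟩ := exists_pos_forall_mem_Ioo_eq K tI t
      have ha0 : 0 ≤ max 0 (t - δ / 2) := le_max_left _ _
      have hat : max 0 (t - δ / 2) < t := max_lt h0 (by linarith)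
      have hno : ∀ k, 1 ≤ k → k ≤ K → tI k ∉ Ioc (max 0 (t - δ / 2)) t :=
        fun k hk1 hkK hmem => hk ⟨k, hk1, hkK, hiso k hk1 hkK
          ⟨by linarith [hmem.1, le_max_right 0 (t - δ / 2)], by linarith [hmem.2]⟩⟩
      rw [h.x_eq _ t ha0 hat.le ht.2 hno, h'.x_eq _ t ha0 hat.le ht.2 hno, hxlt _ hat]
      congr 1
      refine intervalIntegral.integral_congr_Ioo_of_le hat.le fun s hs => ?_
      have hs0 : s ∈ Ico 0 t := ⟨ha0.trans hs.1.le, hs.2⟩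
      have hd : s - τ s < t := by linarith [H.tau_pos hβT h s ⟨hs0.1, hs0.2.le.trans ht.2⟩, hs.2]
      simp only [← hxlt s hs.2, ← (heq s hs0).2, ← hxlt _ hd]
  · rw [h.tau_eq t ht, h'.tau_eq t ht]
    congr 1
    refine intervalIntegral.integral_congr_Ioo_of_le ht.1 fun s hs => ?_
    simp only [(heq s ⟨hs.1.le, hs.2⟩).1, (heq s ⟨hs.1.le, hs.2⟩).2]

/-- Two solutions that agree up to `t` agree slightly beyond `t`. -/
theorem eq_after_of_eq_upto (H : GlobalIIVP n K T lam f g Imp φ tm tI L1 L2 L3 C) {β : ℝ}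
    {x x' : ℝ → (Fin n → ℝ)} {τ τ' : ℝ → ℝ} (hβT : β ≤ T)
    (h : IsIIVPSol n K f g Imp φ lam tI β x τ) (h' : IsIIVPSol n K f g Imp φ lam tI β x' τ')
    {t : ℝ} (ht : t ∈ Ico 0 β) (heq : ∀ s ∈ Icc 0 t, x s = x' s ∧ τ s = τ' s) :
    ∃ u > t, ∀ s ∈ Ioo t u, x s = x' s ∧ τ s = τ' s := by
  have hL1 := H.L1_nonneg
  have hL2 := H.L2_nonneg
  have hβ : 0 ≤ β := ht.1.trans ht.2.le
  have hτt : τ t = τ' t := (heq t ⟨ht.1, le_rfl⟩).2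
  have hxt : x t = x' t := (heq t ⟨ht.1, le_rfl⟩).1
  have hxle : ∀ s ≤ t, x s = x' s := fun s hs => by
    rcases le_total s 0 with hs0 | hs0
    · rw [h.x_init s hs0, h'.x_init s hs0]
    · exact (heq s ⟨hs0, hs⟩).1
  obtain ⟨ε, hε, hεt, L, hL, hlip⟩ := H.exists_lipschitz_right ht.1 (ht.2.le.trans hβT)
    (h.mono ht.2.le) (p := t - τ t) (by linarith [H.tau_pos hβT h t ⟨ht.1, ht.2.le⟩])
  obtain ⟨u₁, hu₁, hu₁β, hdev⟩ := H.exists_deviated_mem hβT h ht hε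
  obtain ⟨u₂, hu₂, -, hdev'⟩ := H.exists_deviated_mem hβT h' ht hε
  rw [← hτt] at hdev'
  obtain ⟨δ, hδ, hiso⟩ := exists_pos_forall_mem_Ioo_eq K tI t
  set Q := L1 * (1 + L) + L2 with hQ
  have hQ0 : 0 ≤ Q := by positivity
  obtain ⟨u, htu, huu₁, huu₂, huδ, huQ⟩ : ∃ u, t < u ∧ u ≤ u₁ ∧ u ≤ u₂ ∧ u < t + δ ∧
      Q * (u - t) ≤ 1 / 2 := by
    have hmin : 0 < min (δ / 2) (1 / (2 * (Q + 1))) := lt_min (by linarith) (by positivity)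
    refine ⟨min (min u₁ u₂) (t + min (δ / 2) (1 / (2 * (Q + 1)))), ?_, ?_, ?_, ?_, ?_⟩
    · exact lt_min (lt_min hu₁ hu₂) (by linarith)
    · exact (min_le_left _ _).trans (min_le_left _ _)
    · exact (min_le_left _ _).trans (min_le_right _ _)
    · exact (min_le_right _ _).trans_lt (by linarith [min_le_left (δ / 2) (1 / (2 * (Q + 1)))])
    · have h1 : min (min u₁ u₂) (t + min (δ / 2) (1 / (2 * (Q + 1)))) - t ≤ 1 / (2 * (Q + 1)) := by
        linarith [min_le_right (min u₁ u₂) (t + min (δ / 2) (1 / (2 * (Q + 1)))),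
          min_le_right (δ / 2) (1 / (2 * (Q + 1)))]
      refine (mul_le_mul_of_nonneg_left h1 hQ0).trans ?_
      rw [mul_one_div, div_le_div_iff₀ (by positivity) (by positivity)]
      linarith
  have huβ : u ≤ β := huu₁.trans hu₁β
  set D : ℝ → ℝ := fun s => ‖x s - x' s‖ + |τ s - τ' s| with hD
  have hno : ∀ s ∈ Icc t u, ∀ k, 1 ≤ k → k ≤ K → tI k ∉ Ioc t s := fun s hs k hk hkK hmem => by
    have := hiso k hk hkK ⟨by linarith [hmem.1], by linarith [hmem.2, hs.2]⟩
    linarith [hmem.1]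
  have hstep : ∀ R, (∀ s ∈ Icc t u, D s ≤ R) → ∀ s ∈ Icc t u, D s ≤ R / 2 := by
    intro R hR s hs
    have hR0 : 0 ≤ R := (by positivity : 0 ≤ D s).trans (hR s hs)
    have hsβ : s ≤ β := hs.2.trans huβ
    have hI := H.intervalIntegrable_of_isIIVPSol hβT h ht.1 hs.1 hsβ
    have hI' := H.intervalIntegrable_of_isIIVPSol hβT h' ht.1 hs.1 hsβ
    have hx : ‖x s - x' s‖ ≤ L1 * (1 + L) * R * (s - t) := by
      rw [h.x_eq t s ht.1 hs.1 hsβ (hno s hs), h'.x_eq t s ht.1 hs.1 hsβ (hno s hs), hxt,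
        add_sub_add_left_eq_sub, ← intervalIntegral.integral_sub hI.1 hI'.1]
      refine (intervalIntegral.norm_integral_le_of_norm_le_const (C := L1 * (1 + L) * R)
        fun r hr => ?_).trans_eq (by rw [abs_of_nonneg (sub_nonneg.2 hs.1)])
      rw [uIoc_of_le hs.1] at hr
      have hru : r ∈ Icc t u := ⟨hr.1.le, hr.2.trans hs.2⟩
      have hd := hdev r ⟨hru.1, hru.2.trans huu₁⟩
      have hd' := hdev' r ⟨hru.1, hru.2.trans huu₂⟩
      have h1 := hlip _ hd _ hd'
      rw [hxle (r - τ' r) (hd'.2.trans hεt), sub_sub_sub_cancel_left, abs_sub_comm] at h1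
      have h2 := hR r hru
      have h3 : 0 ≤ ‖x r - x' r‖ := norm_nonneg _
      have h4 : 0 ≤ |τ r - τ' r| := abs_nonneg _
      simp only [hD] at h2
      have h5 : L * |τ r - τ' r| ≤ L * R := by gcongr; linarith
      refine (H.f_lip r _ _ _ _).trans ?_
      rw [mul_assoc]
      gcongr
      linarith
    have hτ : |τ s - τ' s| ≤ L2 * R * (s - t) := by
      rw [H.tau_eq_add_integral hβT h ht.1 hs.1 hsβ, H.tau_eq_add_integral hβT h' ht.1 hs.1 hsβ,
        hτt, add_sub_add_left_eq_sub, ← intervalIntegral.integral_sub hI.2 hI'.2,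
        ← Real.norm_eq_abs]
      refine (intervalIntegral.norm_integral_le_of_norm_le_const (C := L2 * R)
        fun r hr => ?_).trans_eq (by rw [abs_of_nonneg (sub_nonneg.2 hs.1)])
      rw [uIoc_of_le hs.1] at hr
      refine (H.g_lip r _ _ _ _).trans ?_
      gcongr
      exact hR r ⟨hr.1.le, hr.2.trans hs.2⟩
    calc D s ≤ L1 * (1 + L) * R * (s - t) + L2 * R * (s - t) := add_le_add hx hτ
      _ = Q * (s - t) * R := by rw [hQ]; ring
      _ ≤ 1 / 2 * R := by
        gcongr
        exact (mul_le_mul_of_nonneg_left (by linarith [hs.2]) hQ0).trans huQ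
      _ = R / 2 := by ring
  obtain ⟨M, hM, hbound⟩ := H.exists_uniform_bound
  obtain ⟨hx, hτ, -⟩ := hbound β x τ hβ hβT h
  obtain ⟨hx', hτ', -⟩ := hbound β x' τ' hβ hβT h'
  have hbdd : BddAbove (D '' Icc t u) := by
    refine ⟨2 * M + 2 * M, ?_⟩
    rintro _ ⟨s, hs, rfl⟩
    have hsβ : s ≤ β := hs.2.trans huβ
    have hs0 : s ∈ Icc 0 β := ⟨ht.1.trans hs.1, hsβ⟩
    refine add_le_add ((norm_sub_le _ _).trans (by linarith [hx s hsβ, hx' s hsβ])) ?_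
    rw [abs_le]
    constructor <;> linarith [hτ s hsβ, hτ' s hsβ, H.tau_pos hβT h s hs0, H.tau_pos hβT h' s hs0]
  have hle : ∀ s ∈ Icc t u, D s ≤ sSup (D '' Icc t u) := fun s hs =>
    le_csSup hbdd (mem_image_of_mem D hs)
  have hsup : sSup (D '' Icc t u) ≤ 0 := by
    have : sSup (D '' Icc t u) ≤ sSup (D '' Icc t u) / 2 := by
      refine csSup_le ((nonempty_Icc.2 htu.le).image D) ?_
      rintro _ ⟨s, hs, rfl⟩
      exact hstep _ hle s hs
    linarith
  refine ⟨u, htu, fun s hs => ?_⟩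
  have h1 : ‖x s - x' s‖ + |τ s - τ' s| ≤ 0 := (hle s ⟨hs.1.le, hs.2.le⟩).trans hsup
  have h2 := norm_nonneg (x s - x' s)
  have h3 := abs_nonneg (τ s - τ' s)
  exact ⟨sub_eq_zero.1 (norm_eq_zero.1 (by linarith)), sub_eq_zero.1 (abs_eq_zero.1 (by linarith))⟩

theorem unique (H : GlobalIIVP n K T lam f g Imp φ tm tI L1 L2 L3 C) {β : ℝ}
    {x x' : ℝ → (Fin n → ℝ)} {τ τ' : ℝ → ℝ} (hβT : β ≤ T)
    (h : IsIIVPSol n K f g Imp φ lam tI β x τ) (h' : IsIIVPSol n K f g Imp φ lam tI β x' τ') :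
    ∀ t ≤ β, x t = x' t ∧ τ t = τ' t := by
  have key : ∀ t ∈ Icc 0 β, x t = x' t ∧ τ t = τ' t :=
    forall_mem_Icc_of_left_of_right (fun t ht heq => H.eq_at_of_eq_before hβT h h' ht heq)
      fun t ht heq => H.eq_after_of_eq_upto hβT h h' ht heq
  intro t ht
  rcases le_total t 0 with h0 | h0
  · exact ⟨(h.x_init t h0).trans (h'.x_init t h0).symm,
      (h.tau_init t h0).trans (h'.tau_init t h0).symm⟩
  · exact key t ⟨h0, ht⟩

end GlobalIIVP

end

/-- Local solvability of an ordinary differential equation with a globally Lipschitz vector field. -/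
theorem exists_hasDerivWithinAt_of_lipschitz {E : Type*} [NormedAddCommGroup E] [NormedSpace ℝ E]
    [CompleteSpace E] {v : ℝ → E → E} {K : ℝ} (hK : 0 ≤ K)
    (hv : Continuous fun p : ℝ × E => v p.1 p.2)
    (hlip : ∀ t u w, ‖v t u - v t w‖ ≤ K * ‖u - w‖) (t₀ : ℝ) (u₀ : E) :
    ∃ η > 0, ∃ α : ℝ → E, α t₀ = u₀ ∧
      ∀ t ∈ Icc t₀ (t₀ + η), HasDerivWithinAt α (v t (α t)) (Icc t₀ (t₀ + η)) t := by
  obtain ⟨B, hB⟩ := (isCompact_Icc (a := t₀) (b := t₀ + 1)).exists_bound_of_continuousOn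
    (f := fun t => v t u₀) (by fun_prop)
  have hB0 : 0 ≤ B := (norm_nonneg _).trans (hB t₀ ⟨le_rfl, by linarith⟩)
  have hη : 0 < 1 / (B + K + 1) := by positivity
  have hη1 : 1 / (B + K + 1) ≤ 1 := by
    rw [div_le_one (by positivity)]
    linarith
  have hPL : IsPicardLindelof v (tmin := t₀) (tmax := t₀ + 1 / (B + K + 1))
      ⟨t₀, le_rfl, by linarith⟩ u₀ 1 0 ⟨B + K, by positivity⟩ ⟨K, hK⟩ :=
    { lipschitzOnWith := fun t _ => (LipschitzWith.of_dist_le_mul fun u w => by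
        rw [dist_eq_norm, dist_eq_norm]
        exact hlip t u w).lipschitzOnWith
      continuousOn := fun u _ => by fun_prop
      norm_le := fun t ht u hu => by
        rw [mem_closedBall_iff_norm] at hu
        have h1 := hB t ⟨ht.1, by linarith [ht.2]⟩
        have h2 := hlip t u u₀
        calc ‖v t u‖ = ‖v t u₀ + (v t u - v t u₀)‖ := by rw [add_sub_cancel]
          _ ≤ B + K * 1 := (norm_add_le _ _).trans
            (add_le_add h1 (h2.trans (mul_le_mul_of_nonneg_left hu hK)))
          _ = B + K := by ring
      mul_max_le := by
        simp only [add_sub_cancel_left, sub_self, max_eq_left hη.le]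
        simp only [NNReal.coe_one, NNReal.coe_zero, sub_zero]
        rw [mul_one_div, div_le_one (by positivity)]
        exact le_add_of_nonneg_right zero_le_one }
  obtain ⟨α, hα, hd⟩ := hPL.exists_eq_forall_mem_Icc_hasDerivWithinAt₀
  exact ⟨_, hη, α, hα, hd⟩

/-- The fundamental theorem of calculus for one-sided derivatives on a compact interval. -/
theorem eq_add_integral_of_hasDerivWithinAt {E : Type*} [NormedAddCommGroup E] [NormedSpace ℝ E]
    [CompleteSpace E] {α α' : ℝ → E} {a b : ℝ}
    (hd : ∀ t ∈ Icc a b, HasDerivWithinAt α (α' t) (Icc a b) t) (hc : ContinuousOn α' (Icc a b))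
    {t : ℝ} (ht : t ∈ Icc a b) : α t = α a + ∫ s in a..t, α' s := by
  have hsub : Icc a t ⊆ Icc a b := Icc_subset_Icc_right ht.2
  rw [intervalIntegral.integral_eq_sub_of_hasDerivAt_of_le ht.1
    (fun s hs => (hd s (hsub hs)).continuousWithinAt.mono hsub)
    (fun s hs => (hd s (hsub (Ioo_subset_Icc_self hs))).hasDerivAt
      (Icc_mem_nhds hs.1 (hs.2.trans_le ht.2)))
    ((hc.mono hsub).intervalIntegrable_of_Icc ht.1), add_sub_cancel]

section

variable {n K : ℕ} {T lam : ℝ} {f : ℝ → (Fin n → ℝ) → (Fin n → ℝ) → (Fin n → ℝ)}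
  {g : ℝ → (Fin n → ℝ) → ℝ → ℝ} {Imp : ℕ → (Fin n → ℝ) → (Fin n → ℝ)} {φ : ℝ → (Fin n → ℝ)}
  {tm tI : ℕ → ℝ} {L1 L2 L3 C : ℝ}

namespace GlobalIIVP

/-- The undelayed system obtained by freezing the history of the solution is locally solvable. -/
theorem exists_local_flow (H : GlobalIIVP n K T lam f g Imp φ tm tI L1 L2 L3 C)
    {y : ℝ → (Fin n → ℝ)} {L : ℝ} (hL : 0 ≤ L) (hy : ∀ s r, ‖y s - y r‖ ≤ L * |s - r|)
    (β : ℝ) (ξ : Fin n → ℝ) (θ : ℝ) :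
    ∃ η > 0, ∃ (X : ℝ → (Fin n → ℝ)) (W : ℝ → ℝ),
      ContinuousOn X (Icc β (β + η)) ∧ ContinuousOn W (Icc β (β + η)) ∧ X β = ξ ∧ W β = θ ∧
      ContinuousOn (fun s => f s (X s) (y (s - W s))) (Icc β (β + η)) ∧
      ContinuousOn (fun s => g s (X s) (W s)) (Icc β (β + η)) ∧
      ∀ t ∈ Icc β (β + η), X t = ξ + (∫ s in β..t, f s (X s) (y (s - W s))) ∧
        W t = θ + ∫ s in β..t, g s (X s) (W s) := by
  have hL1 := H.L1_nonneg
  have hL2 := H.L2_nonneg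
  have hyc : Continuous y := by
    refine (LipschitzWith.of_dist_le_mul (K := ⟨L, hL⟩) fun s r => ?_).continuous
    rw [dist_eq_norm, Real.dist_eq]
    exact hy s r
  set v : ℝ → (Fin n → ℝ) × ℝ → (Fin n → ℝ) × ℝ :=
    fun s p => (f s p.1 (y (s - p.2)), g s p.1 p.2) with hv
  have hfc : Continuous fun p : ℝ × (Fin n → ℝ) × ℝ => f p.1 p.2.1 (y (p.1 - p.2.2)) :=
    H.f_cont.comp (by fun_prop : Continuous fun p : ℝ × (Fin n → ℝ) × ℝ =>
      (p.1, p.2.1, y (p.1 - p.2.2)))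
  have hvc : Continuous fun p : ℝ × (Fin n → ℝ) × ℝ => v p.1 p.2 := hfc.prodMk H.g_cont
  have hvlip : ∀ t u w, ‖v t u - v t w‖ ≤ (L1 * (1 + L) + L2 * 2) * ‖u - w‖ := fun t u w => by
    have h1 : ‖u.1 - w.1‖ ≤ ‖u - w‖ := norm_fst_le (u - w)
    have h2 : |u.2 - w.2| ≤ ‖u - w‖ := norm_snd_le (u - w)
    have h3 := hy (t - u.2) (t - w.2)
    rw [sub_sub_sub_cancel_left, abs_sub_comm] at h3
    have h4 : L * |u.2 - w.2| ≤ L * ‖u - w‖ := mul_le_mul_of_nonneg_left h2 hL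
    have h5 : 0 ≤ ‖u - w‖ := norm_nonneg _
    rw [add_mul]
    refine (max_le ((H.f_lip t _ _ _ _).trans ?_) ((H.g_lip t _ _ _ _).trans ?_) :
      max _ _ ≤ _)
    · have : L1 * (‖u.1 - w.1‖ + ‖y (t - u.2) - y (t - w.2)‖) ≤ L1 * ((1 + L) * ‖u - w‖) := by
        gcongr
        linarith
      nlinarith [mul_nonneg hL2 h5]
    · have : L2 * (‖u.1 - w.1‖ + |u.2 - w.2|) ≤ L2 * (2 * ‖u - w‖) := by
        gcongr
        linarith
      have h6 : 0 ≤ L1 * (1 + L) * ‖u - w‖ := by positivity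
      linarith
  obtain ⟨η, hη, α, hα, hd⟩ :=
    exists_hasDerivWithinAt_of_lipschitz (by positivity) hvc hvlip β (ξ, θ)
  have hαc : ContinuousOn α (Icc β (β + η)) := fun t ht => (hd t ht).continuousWithinAt
  have hX : ContinuousOn (fun t => (α t).1) (Icc β (β + η)) := hαc.fst
  have hW : ContinuousOn (fun t => (α t).2) (Icc β (β + η)) := hαc.snd
  have hpair : ContinuousOn (fun t => (t, α t)) (Icc β (β + η)) := continuousOn_id.prodMk hαc
  refine ⟨η, hη, fun t => (α t).1, fun t => (α t).2, hX, hW, by simp [hα], by simp [hα],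
    hfc.comp_continuousOn hpair, H.g_cont.comp_continuousOn hpair, fun t ht => ⟨?_, ?_⟩⟩
  · have := eq_add_integral_of_hasDerivWithinAt (α := fun t => (α t).1)
      (fun s hs => (ContinuousLinearMap.fst ℝ (Fin n → ℝ) ℝ).hasFDerivAt.comp_hasDerivWithinAt s
        (hd s hs)) (hfc.comp_continuousOn hpair) ht
    simp only [hα] at this
    exact this
  · have := eq_add_integral_of_hasDerivWithinAt (α := fun t => (α t).2)
      (fun s hs => (ContinuousLinearMap.snd ℝ (Fin n → ℝ) ℝ).hasFDerivAt.comp_hasDerivWithinAt s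
        (hd s hs)) (H.g_cont.comp_continuousOn hpair) ht
    simp only [hα] at this
    exact this

end GlobalIIVP

end

section

variable {n K : ℕ} {T lam : ℝ} {f : ℝ → (Fin n → ℝ) → (Fin n → ℝ) → (Fin n → ℝ)}
  {g : ℝ → (Fin n → ℝ) → ℝ → ℝ} {Imp : ℕ → (Fin n → ℝ) → (Fin n → ℝ)} {φ : ℝ → (Fin n → ℝ)}
  {tm tI : ℕ → ℝ} {L1 L2 L3 C : ℝ}

namespace GlobalIIVP

/-- A solution on `(-∞, β]` and an impulse-free flow on `[β, u]` whose deviated times lie before `β`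
glue to a solution. -/
theorem exists_isIIVPSol_of_flow (H : GlobalIIVP n K T lam f g Imp φ tm tI L1 L2 L3 C) {β u : ℝ}
    {x X : ℝ → (Fin n → ℝ)} {τ W : ℝ → ℝ} (hβ : 0 ≤ β) (hβT : β ≤ T)
    (h : IsIIVPSol n K f g Imp φ lam tI β x τ) (hu : β < u)
    (hX : ContinuousOn X (Icc β u)) (hW : ContinuousOn W (Icc β u)) (hXβ : X β = x β)
    (hWβ : W β = τ β) (hdev : ∀ s ∈ Icc β u, s - W s ≤ β)
    (hf : IntervalIntegrable (fun s => f s (X s) (x (s - W s))) volume β u)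
    (hg : IntervalIntegrable (fun s => g s (X s) (W s)) volume β u)
    (heq : ∀ t ∈ Icc β u, X t = x β + (∫ s in β..t, f s (X s) (x (s - W s))) ∧
      W t = τ β + ∫ s in β..t, g s (X s) (W s))
    (hno : ∀ k, 1 ≤ k → k ≤ K → tI k ∉ Ioc β u) {u' : ℝ} (hu' : u' ∈ Ioo β u) :
    ∃ x' τ', IsIIVPSol n K f g Imp φ lam tI u' x' τ' := by
  classical
  set x' : ℝ → (Fin n → ℝ) := fun s => if s ≤ β then x s else X s with hx'
  set τ' : ℝ → ℝ := fun s => if s ≤ β then τ s else W s with hτ'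
  have hxl : ∀ s ≤ β, x' s = x s := fun s hs => if_pos hs
  have hτl : ∀ s ≤ β, τ' s = τ s := fun s hs => if_pos hs
  have hxr : ∀ s, β ≤ s → x' s = X s := fun s hs => by
    rcases hs.eq_or_lt with rfl | hs
    · rw [hxl _ le_rfl, hXβ]
    · exact if_neg hs.not_ge
  have hτr : ∀ s, β ≤ s → τ' s = W s := fun s hs => by
    rcases hs.eq_or_lt with rfl | hs
    · rw [hτl _ le_rfl, hWβ]
    · exact if_neg hs.not_ge
  have hFl : ∀ s ∈ Icc 0 β, f s (x' s) (x' (s - τ' s)) = f s (x s) (x (s - τ s)) := fun s hs => by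
    rw [hxl s hs.2, hτl s hs.2, hxl _ (by linarith [H.tau_pos hβT h s hs, hs.2])]
  have hGl : ∀ s ∈ Icc 0 β, g s (x' s) (τ' s) = g s (x s) (τ s) := fun s hs => by
    rw [hxl s hs.2, hτl s hs.2]
  have hFr : ∀ s ∈ Icc β u, f s (x' s) (x' (s - τ' s)) = f s (X s) (x (s - W s)) := fun s hs => by
    rw [hxr s hs.1, hτr s hs.1, hxl _ (hdev s hs)]
  have hGr : ∀ s ∈ Icc β u, g s (x' s) (τ' s) = g s (X s) (W s) := fun s hs => by
    rw [hxr s hs.1, hτr s hs.1]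
  have hIl := H.intervalIntegrable_of_isIIVPSol hβT h le_rfl hβ le_rfl
  have hFIl : ∀ a ∈ Icc 0 β, IntervalIntegrable (fun s => f s (x' s) (x' (s - τ' s))) volume a β :=
    fun a ha => by
      refine .congr (fun s hs => ?_) (H.intervalIntegrable_of_isIIVPSol hβT h ha.1 ha.2 le_rfl).1
      rw [uIoc_of_le ha.2] at hs
      exact (hFl s ⟨ha.1.trans hs.1.le, hs.2⟩).symm
  have hGIl : IntervalIntegrable (fun s => g s (x' s) (τ' s)) volume 0 β :=
    .congr (fun s hs => (hGl s (Ioc_subset_Icc_self (uIoc_of_le hβ ▸ hs))).symm) hIl.2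
  have hFIr : ∀ b ∈ Icc β u, IntervalIntegrable (fun s => f s (x' s) (x' (s - τ' s))) volume β b :=
    fun b hb => by
      refine (IntervalIntegrable.congr (fun s hs =>
        (hFr s (Ioc_subset_Icc_self (uIoc_of_le hu.le ▸ hs))).symm) hf).mono_set ?_
      rw [uIcc_of_le hb.1, uIcc_of_le hu.le]
      exact Icc_subset_Icc_right hb.2
  have hGIr : ∀ b ∈ Icc β u, IntervalIntegrable (fun s => g s (x' s) (τ' s)) volume β b :=
    fun b hb => by
      refine (IntervalIntegrable.congr (fun s hs =>
        (hGr s (Ioc_subset_Icc_self (uIoc_of_le hu.le ▸ hs))).symm) hg).mono_set ?_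
      rw [uIcc_of_le hb.1, uIcc_of_le hu.le]
      exact Icc_subset_Icc_right hb.2
  have hxeqr : ∀ t ∈ Icc β u, x' t = x' β + ∫ s in β..t, f s (x' s) (x' (s - τ' s)) :=
    fun t ht => by
      rw [hxr t ht.1, hxl β le_rfl, (heq t ht).1]
      congr 1
      exact intervalIntegral.integral_congr_Ioo_of_le ht.1 fun s hs =>
        (hFr s ⟨hs.1.le, hs.2.le.trans ht.2⟩).symm
  have hτeqr : ∀ t ∈ Icc β u, τ' t = τ' β + ∫ s in β..t, g s (x' s) (τ' s) :=
    fun t ht => by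
      rw [hτr t ht.1, hτl β le_rfl, (heq t ht).2]
      congr 1
      exact intervalIntegral.integral_congr_Ioo_of_le ht.1 fun s hs =>
        (hGr s ⟨hs.1.le, hs.2.le.trans ht.2⟩).symm
  have hτeql : ∀ t ∈ Icc 0 β, τ' t = lam + ∫ s in (0 : ℝ)..t, g s (x' s) (τ' s) := fun t ht => by
    rw [hτl t ht.2, h.tau_eq t ht]
    congr 1
    exact intervalIntegral.integral_congr_Ioo_of_le ht.1 fun s hs =>
      (hGl s ⟨hs.1.le, hs.2.le.trans ht.2⟩).symm
  have hxeql : ∀ a b, 0 ≤ a → a ≤ b → b ≤ β → (∀ k, 1 ≤ k → k ≤ K → tI k ∉ Ioc a b) →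
      x' b = x' a + ∫ s in a..b, f s (x' s) (x' (s - τ' s)) := fun a b ha hab hb hk => by
    rw [hxl b hb, hxl a (hab.trans hb), h.x_eq a b ha hab hb hk]
    congr 1
    exact intervalIntegral.integral_congr_Ioo_of_le hab fun s hs =>
      (hFl s ⟨ha.trans hs.1.le, hs.2.le.trans hb⟩).symm
  refine ⟨x', τ', fun t ht => (hxl t (ht.trans hβ)).trans (h.x_init t ht),
    fun t ht => (hτl t (ht.trans hβ)).trans (h.tau_init t ht), ?_, fun t ht => ?_, fun t ht => ?_,
    fun k hk hkK hku => ?_, fun a b ha hab hb hk => ?_⟩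
  · refine ContinuousOn.mono (s := Icc 0 β ∪ Icc β u) ?_ ?_
    · exact (h.tau_cont.congr fun s hs => hτl s hs.2).union_of_isClosed
        (hW.congr fun s hs => hτr s hs.1) isClosed_Icc isClosed_Icc
    · rw [Icc_union_Icc_eq_Icc hβ hu.le]
      exact Icc_subset_Icc_right hu'.2.le
  · rcases le_total t β with htβ | htβ
    · exact hτeql t ⟨ht.1, htβ⟩
    · have htu : t ∈ Icc β u := ⟨htβ, ht.2.trans hu'.2.le⟩
      rw [hτeqr t htu, hτeql β ⟨hβ, le_rfl⟩, add_assoc,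
        intervalIntegral.integral_add_adjacent_intervals hGIl (hGIr t htu)]
  · rcases lt_or_ge t β with htβ | htβ
    · rw [hxl t htβ.le]
      refine (h.x_right t ⟨ht.1, htβ.le⟩).congr' ?_
      filter_upwards [nhdsWithin_le_nhds (Iio_mem_nhds htβ)] with s hs
      exact (hxl s (le_of_lt hs)).symm
    · have htu : t < u := ht.2.trans_lt hu'.2
      rw [hxr t htβ, ← nhdsWithin_Icc_eq_nhdsGE htu]
      refine Tendsto.congr' ?_ ((hX t ⟨htβ, htu.le⟩).mono (Icc_subset_Icc_left htβ))
      filter_upwards [self_mem_nhdsWithin] with s hs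
      exact (hxr s (htβ.trans hs.1)).symm
  · have hkβ : tI k ≤ β := not_lt.1 fun hlt => hno k hk hkK ⟨hlt, hku.trans hu'.2.le⟩
    obtain ⟨ξ, hξ, hjump⟩ := h.x_jump k hk hkK hkβ
    refine ⟨ξ, hξ.congr' ?_, (hxl _ hkβ).trans hjump⟩
    filter_upwards [self_mem_nhdsWithin] with s hs
    exact (hxl s ((le_of_lt hs).trans hkβ)).symm
  · have hbu : b ≤ u := hb.trans hu'.2.le
    rcases le_total b β with hbβ | hbβ
    · exact hxeql a b ha hab hbβ hk
    rcases le_total a β with haβ | haβ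
    · rw [hxeqr b ⟨hbβ, hbu⟩, hxeql a β ha haβ le_rfl fun k h1 h2 hm =>
        hk k h1 h2 ⟨hm.1, hm.2.trans hbβ⟩, add_assoc,
        intervalIntegral.integral_add_adjacent_intervals (hFIl a ⟨ha, haβ⟩) (hFIr b ⟨hbβ, hbu⟩)]
    · have hau : a ∈ Icc β u := ⟨haβ, hab.trans hbu⟩
      rw [hxeqr b ⟨hbβ, hbu⟩, hxeqr a hau, add_assoc,
        intervalIntegral.integral_add_adjacent_intervals (hFIr a hau)
          ((hFIr a hau).symm.trans (hFIr b ⟨hbβ, hbu⟩))]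

/-- A solution on `(-∞, β]` with `β < T` extends to the right of `β`. -/
theorem exists_extension (H : GlobalIIVP n K T lam f g Imp φ tm tI L1 L2 L3 C) {β : ℝ}
    {x : ℝ → (Fin n → ℝ)} {τ : ℝ → ℝ} (hβ : 0 ≤ β) (hβT : β ≤ T)
    (h : IsIIVPSol n K f g Imp φ lam tI β x τ) :
    ∃ u > β, ∀ s ∈ Ioo β u, ∃ x' τ', IsIIVPSol n K f g Imp φ lam tI s x' τ' := by
  have hτβ : 0 < τ β := H.tau_pos hβT h β ⟨hβ, le_rfl⟩
  obtain ⟨ε, hε, hεβ, L, hL, hlip⟩ :=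
    H.exists_lipschitz_right hβ hβT h (p := β - τ β) (by linarith)
  set p := β - τ β with hp
  have hpε : p ≤ p + ε := by linarith
  set y : ℝ → (Fin n → ℝ) := fun r => x (projIcc p (p + ε) hpε r) with hy
  have hylip : ∀ s r, ‖y s - y r‖ ≤ L * |s - r| := fun s r =>
    (hlip _ (projIcc p (p + ε) hpε s).2 _ (projIcc p (p + ε) hpε r).2).trans
      (mul_le_mul_of_nonneg_left (abs_projIcc_sub_projIcc hpε) hL)
  have hyx : ∀ r ∈ Icc p (p + ε), y r = x r := fun r hr => by
    simp only [hy, projIcc_of_mem hpε hr]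
  obtain ⟨η, hη, X, W, hX, hW, hXβ, hWβ, hf, hg, heq⟩ :=
    H.exists_local_flow hL hylip β (x β) (τ β)
  obtain ⟨δ, hδ, hiso⟩ := exists_pos_forall_mem_Ioo_eq K tI β
  have hβη : β < β + η := by linarith
  have hWc : ContinuousWithinAt W (Icc β (β + η)) β := hW β ⟨le_rfl, hβη.le⟩
  have hev : ∀ᶠ s in nhdsWithin β (Icc β (β + η)),
      0 < W s ∧ s - W s < p + ε ∧ s < β + δ ∧ s < β + η := by
    refine (hWc.eventually_const_lt (hWβ ▸ hτβ)).and
      (((continuousWithinAt_id.sub hWc).eventually_lt_const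
        (by simp only [Pi.sub_apply, id, hWβ]; linarith)).and ?_)
    exact nhdsWithin_le_nhds ((eventually_lt_nhds (by linarith)).and
      (eventually_lt_nhds (by linarith)))
  rw [nhdsWithin_Icc_eq_nhdsGE hβη] at hev
  obtain ⟨u, hu, hsub⟩ := mem_nhdsGE_iff_exists_Icc_subset.1 hev
  have hβu : β < u := hu
  have huη : u < β + η := (hsub ⟨hβu.le, le_rfl⟩).2.2.2
  have hIcc : Icc β u ⊆ Icc β (β + η) := Icc_subset_Icc_right huη.le
  have hdev : ∀ s ∈ Icc β u, s - W s ∈ Icc p (p + ε) := fun s hs => by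
    refine ⟨?_, (hsub hs).2.1.le⟩
    have hint : ∫ r in β..s, g r (X r) (W r) ≤ ∫ _ in β..s, (1 : ℝ) :=
      intervalIntegral.integral_mono_on hs.1
        ((hg.mono (Icc_subset_Icc_right (hIcc hs).2)).intervalIntegrable_of_Icc hs.1) (by simp)
        fun r hr => (H.g_lt_one r _ _ (hsub ⟨hr.1, hr.2.trans hs.2⟩).1.le).le
    rw [(heq s (hIcc hs)).2]
    simp only [intervalIntegral.integral_const, smul_eq_mul, mul_one] at hint
    linarith
  have hFeq : EqOn (fun s => f s (X s) (y (s - W s))) (fun s => f s (X s) (x (s - W s)))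
      (Icc β u) := fun s hs => by simp only [hyx _ (hdev s hs)]
  refine ⟨u, hu, fun s hs => H.exists_isIIVPSol_of_flow hβ hβT h hu (hX.mono hIcc) (hW.mono hIcc)
    hXβ hWβ (fun s hs => (hdev s hs).2.trans hεβ)
    (((hf.mono hIcc).congr hFeq.symm).intervalIntegrable_of_Icc hβu.le)
    ((hg.mono hIcc).intervalIntegrable_of_Icc hβu.le)
    (fun t ht => ⟨?_, (heq t (hIcc ht)).2⟩) (fun k hk hkK hmem => ?_) hs⟩
  · rw [(heq t (hIcc ht)).1]
    congr 1
    exact intervalIntegral.integral_congr_Ioo_of_le ht.1 fun r hr =>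
      hFeq ⟨hr.1.le, hr.2.le.trans ht.2⟩
  · have := hiso k hk hkK ⟨by linarith [hmem.1],
      hmem.2.trans_lt (hsub ⟨hβu.le, le_rfl⟩).2.2.1⟩
    linarith [hmem.1]

end GlobalIIVP

end

/-- A function that is Lipschitz to the left of `b` has a left limit at `b`. -/
theorem exists_tendsto_nhdsLT_of_lipschitz {E : Type*} [NormedAddCommGroup E] [CompleteSpace E]
    {u : ℝ → E} {a b M : ℝ} (hab : a < b) (hM : 0 ≤ M)
    (hu : ∀ s r, a ≤ s → s ≤ r → r < b → ‖u r - u s‖ ≤ M * (r - s)) :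
    ∃ ξ, Tendsto u (nhdsWithin b (Iio b)) (nhds ξ) := by
  have hlip : LipschitzOnWith ⟨M, hM⟩ u (Ico a b) := by
    refine LipschitzOnWith.of_dist_le_mul fun s hs r hr => ?_
    rw [dist_eq_norm, Real.dist_eq]
    rcases le_total s r with hsr | hsr
    · rw [norm_sub_rev, abs_sub_comm, abs_of_nonneg (sub_nonneg.2 hsr)]
      exact hu s r hs.1 hsr hr.2
    · rw [abs_of_nonneg (sub_nonneg.2 hsr)]
      exact hu r s hr.1 hsr hs.2
  have hc : Cauchy (map u (nhdsWithin b (Iio b))) :=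
    Cauchy.map_of_le (cauchy_nhds.mono nhdsWithin_le_nhds) hlip.uniformContinuousOn
      (le_principal_iff.2 (Ico_mem_nhdsLT hab))
  exact cauchy_map_iff_exists_tendsto.1 hc

/-- An integral equation passes to the left limit. -/
theorem eq_add_integral_of_tendsto_nhdsLT {E : Type*} [NormedAddCommGroup E] [NormedSpace ℝ E]
    {u F : ℝ → E} {a b : ℝ} {c ξ : E} (hab : a < b) (hF : IntervalIntegrable F volume a b)
    (hu : ∀ s ∈ Ico a b, u s = c + ∫ r in a..s, F r)
    (hξ : Tendsto u (nhdsWithin b (Iio b)) (nhds ξ)) : ξ = c + ∫ r in a..b, F r := by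
  have hcont : ContinuousWithinAt (fun s => ∫ r in a..s, F r) (Icc a b) b := by
    have := intervalIntegral.continuousOn_primitive_interval' hF left_mem_uIcc
    rw [uIcc_of_le hab.le] at this
    exact this b ⟨hab.le, le_rfl⟩
  have hlim : Tendsto (fun s => c + ∫ r in a..s, F r) (nhdsWithin b (Iio b))
      (nhds (c + ∫ r in a..b, F r)) := by
    rw [← nhdsWithin_Ico_eq_nhdsLT hab]
    exact (hcont.mono Ico_subset_Icc_self).const_add c
  refine tendsto_nhds_unique hξ (hlim.congr' ?_)
  filter_upwards [Ico_mem_nhdsLT hab] with s hs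
  exact (hu s hs).symm

section

variable {n K : ℕ} {T lam : ℝ} {f : ℝ → (Fin n → ℝ) → (Fin n → ℝ) → (Fin n → ℝ)}
  {g : ℝ → (Fin n → ℝ) → ℝ → ℝ} {Imp : ℕ → (Fin n → ℝ) → (Fin n → ℝ)} {φ : ℝ → (Fin n → ℝ)}
  {tm tI : ℕ → ℝ} {L1 L2 L3 C : ℝ}

namespace GlobalIIVP

theorem exists_isIIVPSol_zero (H : GlobalIIVP n K T lam f g Imp φ tm tI L1 L2 L3 C) :
    ∃ x τ, IsIIVPSol n K f g Imp φ lam tI 0 x τ := by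
  refine ⟨fun t => φ (min t 0), fun _ => lam, fun t ht => by simp only [min_eq_left ht],
    fun _ _ => rfl, continuousOn_const, fun t ht => ?_, fun t ht => ?_, fun k hk hkK hk0 => ?_,
    fun a b ha hab hb _ => ?_⟩
  · obtain rfl : t = 0 := le_antisymm ht.2 ht.1
    simp
  · obtain rfl : t = 0 := le_antisymm ht.2 ht.1
    refine tendsto_const_nhds.congr' ?_
    filter_upwards [self_mem_nhdsWithin] with s hs
    simp only [min_self, min_eq_right (mem_Ici.1 hs)]
  · exact absurd hk0 (H.tI_pos hk hkK).not_ge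
  · obtain rfl : a = 0 := le_antisymm (hab.trans hb) ha
    obtain rfl : b = 0 := le_antisymm hb hab
    simp

/-- Solutions on all smaller intervals come from a single pair of functions. -/
theorem exists_forall_isIIVPSol (H : GlobalIIVP n K T lam f g Imp φ tm tI L1 L2 L3 C) {β : ℝ}
    (hβT : β ≤ T) (hex : ∀ s ∈ Ico 0 β, ∃ x τ, IsIIVPSol n K f g Imp φ lam tI s x τ) :
    ∃ x τ, ∀ s ∈ Ico 0 β, IsIIVPSol n K f g Imp φ lam tI s x τ := by
  choose! X W hsol using hex
  have hagree : ∀ s ∈ Ico 0 β, ∀ t ≤ s, X (max t 0) t = X s t ∧ W (max t 0) t = W s t :=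
    fun s hs t ht => by
      have hts : max t 0 ≤ s := max_le ht hs.1
      exact H.unique (hts.trans (hs.2.le.trans hβT)) (hsol _ ⟨le_max_right _ _, hts.trans_lt hs.2⟩)
        ((hsol s hs).mono hts) t (le_max_left _ _)
  refine ⟨fun t => X (max t 0) t, fun t => W (max t 0) t, fun s hs => ?_⟩
  have hs' : (s + β) / 2 ∈ Ico 0 β := ⟨by linarith [hs.1, hs.2], by linarith [hs.2]⟩
  exact (hsol _ hs').congr_of_lt (H.tau_pos (hs'.2.le.trans hβT) (hsol _ hs'))
    (fun t ht => (hagree _ hs' t ht).1) (fun t ht => (hagree _ hs' t ht).2)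
    (by linarith [hs.2]) hs.1

/-- A pair solving the problem on all smaller intervals has left limits at the endpoint. -/
theorem exists_left_limits (H : GlobalIIVP n K T lam f g Imp φ tm tI L1 L2 L3 C) {β : ℝ}
    {x : ℝ → (Fin n → ℝ)} {τ : ℝ → ℝ} (hβ : 0 < β) (hβT : β ≤ T)
    (h : ∀ s ∈ Ico 0 β, IsIIVPSol n K f g Imp φ lam tI s x τ) :
    ∃ ξ θ, Tendsto x (nhdsWithin β (Iio β)) (nhds ξ) ∧
      Tendsto τ (nhdsWithin β (Iio β)) (nhds θ) := by
  obtain ⟨M, hM, hbound⟩ := H.exists_uniform_bound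
  obtain ⟨δ, hδ, hiso⟩ := exists_pos_forall_mem_Ioo_eq K tI β
  obtain ⟨ξ, hξ⟩ := exists_tendsto_nhdsLT_of_lipschitz (u := x) (a := max 0 (β - δ / 2)) (b := β)
    (max_lt hβ (by linarith)) hM fun s r hs hsr hr => by
      have hs0 : 0 ≤ s := (le_max_left _ _).trans hs
      have hsδ : β - δ / 2 ≤ s := (le_max_right _ _).trans hs
      have hr0 := hs0.trans hsr
      refine (hbound r x τ hr0 (hr.le.trans hβT) (h r ⟨hr0, hr⟩)).2.2.1 s r hs0 hsr le_rfl
        fun k hk hkK hmem => ?_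
      have := hiso k hk hkK ⟨by linarith [hmem.1], by linarith [hmem.2]⟩
      linarith [hmem.2]
  obtain ⟨θ, hθ⟩ := exists_tendsto_nhdsLT_of_lipschitz (u := τ) (a := 0) (b := β) hβ hM
    fun s r hs hsr hr => (hbound r x τ (hs.trans hsr) (hr.le.trans hβT)
      (h r ⟨hs.trans hsr, hr⟩)).2.2.2 s r hs hsr le_rfl
  exact ⟨ξ, θ, hξ, hθ⟩

/-- The value prescribed by the impulses at `β`, given the left limit there. -/
theorem exists_impulse_value (H : GlobalIIVP n K T lam f g Imp φ tm tI L1 L2 L3 C) (β : ℝ)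
    (ξ : Fin n → ℝ) : ∃ v, (∀ k, 1 ≤ k → k ≤ K → tI k = β → v = ξ + Imp k ξ) ∧
      ((∀ k, 1 ≤ k → k ≤ K → tI k ≠ β) → v = ξ) := by
  by_cases hk : ∃ k, 1 ≤ k ∧ k ≤ K ∧ tI k = β
  · obtain ⟨k, hk1, hkK, hkβ⟩ := hk
    refine ⟨ξ + Imp k ξ, fun j hj hjK hjβ => ?_, fun hno => absurd hkβ (hno k hk1 hkK)⟩
    rcases lt_trichotomy k j with hkj | rfl | hkj
    · exact absurd (hkβ.trans hjβ.symm) (H.tI_lt j (by omega) k hkj).ne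
    · rfl
    · exact absurd (hjβ.trans hkβ.symm) (H.tI_lt k (by omega) j hkj).ne
  · exact ⟨ξ, fun k hk1 hkK hkβ => absurd ⟨k, hk1, hkK, hkβ⟩ hk, fun _ => rfl⟩

/-- If solutions exist on all smaller intervals, a solution exists up to and including `β`. -/
theorem exists_isIIVPSol_of_forall_lt (H : GlobalIIVP n K T lam f g Imp φ tm tI L1 L2 L3 C) {β : ℝ}
    (hβ : 0 ≤ β) (hβT : β ≤ T)
    (hex : ∀ s ∈ Ico 0 β, ∃ x τ, IsIIVPSol n K f g Imp φ lam tI s x τ) :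
    ∃ x τ, IsIIVPSol n K f g Imp φ lam tI β x τ := by
  rcases hβ.eq_or_lt with rfl | hβ
  · exact H.exists_isIIVPSol_zero
  obtain ⟨x₀, τ₀, h₀⟩ := H.exists_forall_isIIVPSol hβT hex
  obtain ⟨ξ, θ, hξ₀, hθ₀⟩ := H.exists_left_limits hβ hβT h₀
  obtain ⟨v, hvI, hv⟩ := H.exists_impulse_value β ξ
  classical
  set x : ℝ → (Fin n → ℝ) := fun t => if t < β then x₀ t else v with hx
  set τ : ℝ → ℝ := fun t => if t < β then τ₀ t else θ with hτ
  have hxl : ∀ t < β, x t = x₀ t := fun t ht => if_pos ht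
  have hτl : ∀ t < β, τ t = τ₀ t := fun t ht => if_pos ht
  have hxr : ∀ t, β ≤ t → x t = v := fun t ht => if_neg ht.not_gt
  have hτβ : τ β = θ := if_neg (lt_irrefl β)
  have hξ : Tendsto x (nhdsWithin β (Iio β)) (nhds ξ) := hξ₀.congr' <| by
    filter_upwards [self_mem_nhdsWithin] with s hs
    exact (hxl s hs).symm
  have hθ : Tendsto τ (nhdsWithin β (Iio β)) (nhds θ) := hθ₀.congr' <| by
    filter_upwards [self_mem_nhdsWithin] with s hs
    exact (hτl s hs).symm
  have h : ∀ s ∈ Ico 0 β, IsIIVPSol n K f g Imp φ lam tI s x τ := fun s hs => by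
    have hs' : (s + β) / 2 ∈ Ico 0 β := ⟨by linarith [hs.1, hs.2], by linarith [hs.2]⟩
    exact (h₀ _ hs').congr_of_lt (H.tau_pos (hs'.2.le.trans hβT) (h₀ _ hs'))
      (fun t ht => hxl t (ht.trans_lt hs'.2)) (fun t ht => hτl t (ht.trans_lt hs'.2))
      (by linarith [hs.2]) hs.1
  have hinit := (h 0 ⟨le_rfl, hβ⟩).x_init
  have hlt : ∀ t < β, IsIIVPSol n K f g Imp φ lam tI (max t 0) x τ := fun t ht =>
    h _ ⟨le_max_right _ _, max_lt ht hβ⟩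
  have hmid : ∀ t ∈ Ico 0 β, (t + β) / 2 ∈ Ico 0 β := fun t ht =>
    ⟨by linarith [ht.1, ht.2], by linarith [ht.2]⟩
  have hpos : ∀ t ∈ Icc 0 β, 0 ≤ τ t := fun t ht => by
    rcases ht.2.eq_or_lt with rfl | htβ
    · rw [hτβ]
      refine ge_of_tendsto hθ ?_
      filter_upwards [Ico_mem_nhdsLT hβ] with s hs
      exact (H.tau_pos (hs.2.le.trans hβT) (h s hs) s ⟨hs.1, le_rfl⟩).le
    · exact (H.tau_pos (ht.2.trans hβT) (h t ⟨ht.1, htβ⟩) t ⟨ht.1, le_rfl⟩).le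
  have hτc : ContinuousOn τ (Icc 0 β) := fun t ht => by
    rcases ht.2.eq_or_lt with rfl | htβ
    · have : ContinuousWithinAt τ (insert t (Iio t)) t :=
        continuousWithinAt_insert_self.2 (by rw [ContinuousWithinAt, hτβ]; exact hθ)
      rw [Iio_insert] at this
      exact this.mono Icc_subset_Iic_self
    · have hm := hmid t ⟨ht.1, htβ⟩
      refine ((h _ hm).tau_cont t ⟨ht.1, by linarith⟩).mono_of_mem_nhdsWithin ?_
      filter_upwards [self_mem_nhdsWithin,
        nhdsWithin_le_nhds (Iio_mem_nhds (show t < (t + β) / 2 by linarith))] with s hs hs'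
      exact ⟨hs.1, le_of_lt hs'⟩
  have hr : ∀ t ≤ β, Tendsto x (nhdsWithin t (Ici t)) (nhds (x t)) := fun t ht => by
    rcases ht.eq_or_lt with rfl | htβ
    · refine tendsto_const_nhds.congr' ?_
      filter_upwards [self_mem_nhdsWithin] with s hs
      rw [hxr s hs, hxr t le_rfl]
    · exact H.x_tendsto_right (hlt t htβ).x_init (hlt t htβ).x_right t (le_max_left _ _)
  obtain ⟨M, hM, hbound⟩ := H.exists_uniform_bound
  have hxM : ∀ t ≤ β, ‖x t‖ ≤ max M ‖v‖ := fun t ht => by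
    rcases ht.eq_or_lt with rfl | htβ
    · rw [hxr t le_rfl]
      exact le_max_right _ _
    · exact ((hbound _ x τ (le_max_right _ _) ((max_lt htβ hβ).le.trans hβT) (hlt t htβ)).1 t
        (le_max_left _ _)).trans (le_max_left _ _)
  obtain ⟨hF, hG⟩ := H.intervalIntegrable_rhs hβ.le hr hxM hτc hpos
  refine ⟨x, τ, hinit, (h 0 ⟨le_rfl, hβ⟩).tau_init, hτc, fun t ht => ?_, fun t ht => hr t ht.2,
    fun k hk hkK hkβ => ?_, fun a b ha hab hb hno => ?_⟩
  · rcases ht.2.eq_or_lt with rfl | htβ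
    · rw [hτβ]
      exact eq_add_integral_of_tendsto_nhdsLT hβ hG
        (fun s hs => (h s hs).tau_eq s ⟨hs.1, le_rfl⟩) hθ
    · exact (h t ⟨ht.1, htβ⟩).tau_eq t ⟨ht.1, le_rfl⟩
  · rcases hkβ.eq_or_lt with hkβ | hkβ
    · refine ⟨ξ, hkβ ▸ hξ, ?_⟩
      rw [hkβ, hxr β le_rfl]
      exact hvI k hk hkK hkβ
    · exact (h _ ⟨(H.tI_pos hk hkK).le, hkβ⟩).x_jump k hk hkK le_rfl
  · rcases hb.eq_or_lt with rfl | hbβ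
    · rcases hab.eq_or_lt with rfl | hab
      · simp
      rw [hxr b le_rfl, hv fun k hk hkK hkb => hno k hk hkK ⟨hkb ▸ hab, hkb.le⟩]
      refine eq_add_integral_of_tendsto_nhdsLT hab (hF.mono_set ?_) (fun s hs => ?_) hξ
      · rw [uIcc_of_le hab.le, uIcc_of_le hβ.le]
        exact Icc_subset_Icc_left ha
      · exact (h s ⟨ha.trans hs.1, hs.2⟩).x_eq a s ha hs.1 le_rfl fun k hk hkK hmem =>
          hno k hk hkK ⟨hmem.1, hmem.2.trans hs.2.le⟩
    · exact (h b ⟨ha.trans hab, hbβ⟩).x_eq a b ha hab le_rfl hno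

/-- The problem has a solution on `(-∞, T]`. -/
theorem exists_isIIVPSol (H : GlobalIIVP n K T lam f g Imp φ tm tI L1 L2 L3 C) :
    ∃ x τ, IsIIVPSol n K f g Imp φ lam tI T x τ :=
  forall_mem_Icc_of_left_of_right (P := fun β => ∃ x τ, IsIIVPSol n K f g Imp φ lam tI β x τ)
    (fun _ ht hex => H.exists_isIIVPSol_of_forall_lt ht.1 ht.2 hex)
    (fun t ht hex => by
      obtain ⟨x, τ, h⟩ := hex t ⟨ht.1, le_rfl⟩
      exact H.exists_extension ht.1 ht.2.le h) T ⟨H.T_pos.le, le_rfl⟩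

/-- Positivity, boundedness and Lipschitz estimates for the solution. -/
theorem exists_estimates (H : GlobalIIVP n K T lam f g Imp φ tm tI L1 L2 L3 C)
    {x : ℝ → (Fin n → ℝ)} {τ : ℝ → ℝ} (h : IsIIVPSol n K f g Imp φ lam tI T x τ) :
    ∃ M1 M2 M3 : ℝ, 0 ≤ M1 ∧ 0 ≤ M2 ∧ 0 ≤ M3 ∧
      (∀ t ∈ Icc (0 : ℝ) T, 0 < τ t) ∧
      (∀ t ≤ T, ‖x t‖ + τ t ≤ M1) ∧
      (∀ t ∈ Icc (-lam) T, ∀ tb ∈ Icc (-lam) T, t ≤ tb →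
        (∀ k, 1 ≤ k → k ≤ K → tI k ∉ Ioc t tb) →
        (∀ k : ℕ, tm k ∉ Ioc t tb) →
        ‖x tb - x t‖ ≤ M2 * |tb - t|) ∧
      (∀ t ∈ Icc (0 : ℝ) T, ∀ tb ∈ Icc (0 : ℝ) T, |τ t - τ tb| ≤ M3 * |t - tb|) := by
  obtain ⟨M, hM, hbound⟩ := H.exists_uniform_bound
  obtain ⟨hx, hτ, hxlip, hτlip⟩ := hbound T x τ H.T_pos.le le_rfl h
  obtain ⟨L, hL, hφ⟩ := H.exists_hist_lipschitz
  refine ⟨M + M, max M L, M, by linarith, hM.trans (le_max_left _ _), hM, H.tau_pos le_rfl h,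
    fun t ht => add_le_add (hx t ht) (hτ t ht), fun t ht tb htb hle hI hm => ?_,
    fun t ht tb htb => ?_⟩
  · rcases lt_or_ge t 0 with ht0 | ht0
    · have htb0 : tb < 0 := not_le.1 fun hge => hm 0 (H.hist.1.symm ▸ ⟨ht0, hge⟩)
      rw [h.x_init t ht0.le, h.x_init tb htb0.le]
      exact (hφ t ⟨ht.1, ht0⟩ tb ⟨htb.1, htb0⟩ hle hm).trans
        (mul_le_mul_of_nonneg_right (le_max_right _ _) (abs_nonneg _))
    · refine (hxlip t tb ht0 hle htb.2 hI).trans ?_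
      rw [abs_of_nonneg (sub_nonneg.2 hle)]
      exact mul_le_mul_of_nonneg_right (le_max_left _ _) (sub_nonneg.2 hle)
  · rcases le_total t tb with hle | hle
    · rw [abs_sub_comm, abs_sub_comm t, abs_of_nonneg (sub_nonneg.2 hle)]
      exact hτlip t tb ht.1 hle htb.2
    · rw [abs_of_nonneg (sub_nonneg.2 hle)]
      exact hτlip tb t htb.1 hle ht.2

end GlobalIIVP

end

/-- Solutions only depend on the values of the right-hand sides on the time interval. -/
theorem IsIIVPSol.congr_rhs {n K : ℕ} {T lam : ℝ}
    {f f' : ℝ → (Fin n → ℝ) → (Fin n → ℝ) → (Fin n → ℝ)} {g g' : ℝ → (Fin n → ℝ) → ℝ → ℝ}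
    {Imp : ℕ → (Fin n → ℝ) → (Fin n → ℝ)} {φ : ℝ → (Fin n → ℝ)} {tI : ℕ → ℝ}
    {x : ℝ → (Fin n → ℝ)} {τ : ℝ → ℝ} (hf : ∀ t ∈ Icc 0 T, f t = f' t)
    (hg : ∀ t ∈ Icc 0 T, g t = g' t) (h : IsIIVPSol n K f g Imp φ lam tI T x τ) :
    IsIIVPSol n K f' g' Imp φ lam tI T x τ := by
  refine ⟨h.x_init, h.tau_init, h.tau_cont, fun t ht => ?_, h.x_right, h.x_jump,
    fun a b ha hab hb hk => ?_⟩
  · rw [h.tau_eq t ht]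
    congr 1
    exact intervalIntegral.integral_congr_Ioo_of_le ht.1 fun s hs => by
      simp only [hg s ⟨hs.1.le, hs.2.le.trans ht.2⟩]
  · rw [h.x_eq a b ha hab hb hk]
    congr 1
    exact intervalIntegral.integral_congr_Ioo_of_le hab fun s hs => by
      simp only [hf s ⟨ha.trans hs.1.le, hs.2.le.trans hb⟩]

/-- Corollary 3.4: let `λ > 0` and assume (A1)–(A4) where `f` and `g` are
globally Lipschitz continuous in their last two arguments (constants
independent of `M`), and moreover `g(t,u,w) < 1` for all `t ∈ [0,T]`,
`u ∈ ℝⁿ` and `w ≥ 0`. Then the impulsive initial value problem has a unique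
solution `(x,τ)` on `(-∞,T]`, and `τ > 0` on `[0,T]`,
`‖x(t)‖ + τ(t) ≤ M₁` on `(-∞,T]`, the Lipschitz estimates hold with suitable
constants `M₂`, `M₃` (with `α = T`). -/
theorem stmt5 (n K : ℕ) (T lam : ℝ) (hT : 0 < T) (hlam : 0 < lam)
    (f : ℝ → (Fin n → ℝ) → (Fin n → ℝ) → (Fin n → ℝ))
    (g : ℝ → (Fin n → ℝ) → ℝ → ℝ) (Imp : ℕ → (Fin n → ℝ) → (Fin n → ℝ))
    (φ : ℝ → (Fin n → ℝ)) (tm : ℕ → ℝ)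
    -- (A1) with a global Lipschitz constant:
    (hfc : ContinuousOn (fun p : ℝ × (Fin n → ℝ) × (Fin n → ℝ) => f p.1 p.2.1 p.2.2)
      (Icc 0 T ×ˢ (univ : Set (Fin n → ℝ)) ×ˢ (univ : Set (Fin n → ℝ))))
    (L1 : ℝ) (hL1 : 0 ≤ L1)
    (hfL : ∀ t ∈ Icc (0 : ℝ) T, ∀ u ub v vb : Fin n → ℝ,
      ‖f t u v - f t ub vb‖ ≤ L1 * (‖u - ub‖ + ‖v - vb‖))
    -- (A2) with a global Lipschitz constant:
    (hgc : ContinuousOn (fun p : ℝ × (Fin n → ℝ) × ℝ => g p.1 p.2.1 p.2.2)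
      (Icc 0 T ×ˢ (univ : Set (Fin n → ℝ)) ×ˢ (univ : Set ℝ)))
    (hgpos : ∀ t ∈ Icc (0 : ℝ) T, ∀ u : Fin n → ℝ, 0 < g t u 0)
    (L2 : ℝ) (hL2 : 0 ≤ L2)
    (hgL : ∀ t ∈ Icc (0 : ℝ) T, ∀ u ub : Fin n → ℝ, ∀ w wb : ℝ,
      |g t u w - g t ub wb| ≤ L2 * (‖u - ub‖ + |w - wb|))
    (hA3 : AssumptionA3 n K Imp) (hA4 : AssumptionA4 n φ tm)
    (tI : ℕ → ℝ) (htI0 : tI 0 = 0) (htIK : tI (K + 1) = T)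
    (htImono : ∀ k ≤ K, tI k < tI (k + 1))
    -- `g(t,u,w) < 1` for all `t ∈ [0,T]`, `u ∈ ℝⁿ`, `w ∈ [0,∞)`:
    (hg1 : ∀ t ∈ Icc (0 : ℝ) T, ∀ u : Fin n → ℝ, ∀ w : ℝ, 0 ≤ w → g t u w < 1) :
    ∃ x τ, IsIIVPSol n K f g Imp φ lam tI T x τ ∧
      (∃ M1 M2 M3 : ℝ, 0 ≤ M1 ∧ 0 ≤ M2 ∧ 0 ≤ M3 ∧
        (∀ t ∈ Icc (0 : ℝ) T, 0 < τ t) ∧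
        (∀ t ≤ T, ‖x t‖ + τ t ≤ M1) ∧
        (∀ t ∈ Icc (-lam) T, ∀ tb ∈ Icc (-lam) T, t ≤ tb →
          (∀ k, 1 ≤ k → k ≤ K → tI k ∉ Ioc t tb) →
          (∀ k : ℕ, tm k ∉ Ioc t tb) →
          ‖x tb - x t‖ ≤ M2 * |tb - t|) ∧
        (∀ t ∈ Icc (0 : ℝ) T, ∀ tb ∈ Icc (0 : ℝ) T,
            |τ t - τ tb| ≤ M3 * |t - tb|)) ∧
      (∀ x' τ', IsIIVPSol n K f g Imp φ lam tI T x' τ' →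
        ∀ t ≤ T, x' t = x t ∧ τ' t = τ t) := by
  have hproj : ∀ t ∈ Icc 0 T, (projIcc 0 T hT.le t : ℝ) = t := fun t ht => by
    rw [projIcc_of_mem hT.le ht]
  have hmem : ∀ t, (projIcc 0 T hT.le t : ℝ) ∈ Icc 0 T := fun t => (projIcc 0 T hT.le t).2
  have hprojc : Continuous fun t => (projIcc 0 T hT.le t : ℝ) :=
    continuous_subtype_val.comp continuous_projIcc
  have hfeq : ∀ t ∈ Icc 0 T, f (projIcc 0 T hT.le t) = f t := fun t ht => by rw [hproj t ht]
  have hgeq : ∀ t ∈ Icc 0 T, g (projIcc 0 T hT.le t) = g t := fun t ht => by rw [hproj t ht]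
  have hf' : Continuous fun p : ℝ × (Fin n → ℝ) × (Fin n → ℝ) =>
      f (projIcc 0 T hT.le p.1) p.2.1 p.2.2 :=
    hfc.comp_continuous (f := fun p : ℝ × (Fin n → ℝ) × (Fin n → ℝ) =>
      ((projIcc 0 T hT.le p.1 : ℝ), p.2)) (by fun_prop)
      fun p => ⟨hmem p.1, mem_univ _, mem_univ _⟩
  have hg' : Continuous fun p : ℝ × (Fin n → ℝ) × ℝ => g (projIcc 0 T hT.le p.1) p.2.1 p.2.2 :=
    hgc.comp_continuous (f := fun p : ℝ × (Fin n → ℝ) × ℝ =>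
      ((projIcc 0 T hT.le p.1 : ℝ), p.2)) (by fun_prop)
      fun p => ⟨hmem p.1, mem_univ _, mem_univ _⟩
  obtain ⟨Cf, hCf⟩ := (isCompact_Icc (a := (0 : ℝ)) (b := T)).exists_bound_of_continuousOn
    (f := fun t => f (projIcc 0 T hT.le t) 0 0)
    (hf'.comp (by fun_prop : Continuous fun t : ℝ => (t, (0 : Fin n → ℝ), (0 : Fin n → ℝ)))).continuousOn
  obtain ⟨Cg, hCg⟩ := (isCompact_Icc (a := (0 : ℝ)) (b := T)).exists_bound_of_continuousOn
    (f := fun t => g (projIcc 0 T hT.le t) 0 0)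
    (hg'.comp (by fun_prop : Continuous fun t : ℝ => (t, (0 : Fin n → ℝ), (0 : ℝ)))).continuousOn
  obtain ⟨CI, hCI⟩ := ((finite_Icc 1 K).image fun k => ‖Imp k 0‖).bddAbove
  obtain ⟨N, hN, hφN⟩ := hA4.2.2.2.2.1
  obtain ⟨L3, hL3, hImp⟩ := hA3
  have H : GlobalIIVP n K T lam (fun t => f (projIcc 0 T hT.le t))
      (fun t => g (projIcc 0 T hT.le t)) Imp φ tm tI L1 L2 L3 (max (max Cf Cg) (max CI N)) :=
    { T_pos := hT
      lam_pos := hlam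
      L1_nonneg := hL1
      L2_nonneg := hL2
      L3_nonneg := hL3
      C_nonneg := hN.trans ((le_max_right _ _).trans (le_max_right _ _))
      f_cont := hf'
      f_lip := fun t => hfL _ (hmem t)
      f_zero := fun t => by
        have := hCf _ (hmem t)
        rw [hproj _ (hmem t)] at this
        exact this.trans ((le_max_left _ _).trans (le_max_left _ _))
      g_cont := hg'
      g_lip := fun t => hgL _ (hmem t)
      g_zero := fun t => by
        have := hCg _ (hmem t)
        rw [hproj _ (hmem t)] at this
        exact this.trans ((le_max_right _ _).trans (le_max_left _ _))
      g_pos := fun t => hgpos _ (hmem t)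
      g_lt_one := fun t => hg1 _ (hmem t)
      imp_lip := hImp
      imp_zero := fun k hk hkK => (hCI (mem_image_of_mem _ ⟨hk, hkK⟩)).trans
        ((le_max_left _ _).trans (le_max_right _ _))
      hist := hA4
      hist_le := fun s hs => (hφN s hs).trans ((le_max_right _ _).trans (le_max_right _ _))
      tI_zero := htI0
      tI_last := htIK
      tI_mono := htImono }
  obtain ⟨x, τ, h⟩ := H.exists_isIIVPSol
  exact ⟨x, τ, h.congr_rhs hfeq hgeq, H.exists_estimates h, fun x' τ' h' =>
    H.unique le_rfl (h'.congr_rhs (fun t ht => (hfeq t ht).symm) fun t ht => (hgeq t ht).symm) h⟩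
end

section
/- Assume (A1)–(A4) with f and g globally Lipschitz in their last two arguments (constants L₁ and L₂ independent of M), let λ>0, 0<h<h₀, and set L=L₁+L₂. Suppose (x_h,τ_h) is a solution of the EPCA impulsive initial value problem on (−∞,β] for some 0<β≤T with τ_h(t) ≥ 0 for all t∈[0,β]. Then for all t∈[0,β]: |x_h(t)| + τ_h(t) ≤ (N_φ + λ + T·max_{s∈[0,T]}|f(s,0,0)| + T·max_{s∈[0,T]}|g(s,0,0)| + max_{k=1,…,K}|I_k(0)|) · (Σ_{j=0}^{K} (1+L₃)^j) · e^{2Lt}. -/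
open Set Filter MeasureTheory

lemma flr_le {h : ℝ} (hh : 0 < h) (t : ℝ) : flr h t ≤ t :=
  (le_div_iff₀ hh).1 (Int.floor_le (t / h))

lemma flr_nonneg {h : ℝ} (hh : 0 < h) {t : ℝ} (ht : 0 ≤ t) : 0 ≤ flr h t :=
  mul_nonneg (by exact_mod_cast Int.floor_nonneg.2 (div_nonneg ht hh.le)) hh.le

lemma flr_le_of_lt {h : ℝ} (hh : 0 < h) {t : ℝ} {m : ℕ} (ht : t < (m + 1) * h) :
    flr h t ≤ m * h := by
  have h1 : ⌊t / h⌋ < (m : ℤ) + 1 := by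
    rw [Int.floor_lt]
    push_cast
    exact (div_lt_iff₀ hh).2 ht
  have h2 : (⌊t / h⌋ : ℝ) ≤ m := by exact_mod_cast Int.lt_add_one_iff.1 h1
  exact mul_le_mul_of_nonneg_right h2 hh.le

/-- Any function of the piecewise-constant argument is interval integrable. -/
lemma intervalIntegrable_comp_flr {h : ℝ} (hh : 0 < h) (F : ℝ → ℝ) (a b : ℝ) :
    IntervalIntegrable (fun s => F (flr h s)) volume a b := by
  have hmeas : Measurable fun s => F (flr h s) := by
    have h1 : Measurable fun s : ℝ => ⌊s / h⌋ :=
      Int.measurable_floor.comp (measurable_id.div_const h)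
    exact (measurable_from_top (f := fun z : ℤ => F (z * h))).comp h1
  obtain ⟨C, hC⟩ :
      ∃ C, ∀ z ∈ Finset.Icc ⌊min a b / h⌋ ⌊max a b / h⌋, ‖F ((z : ℝ) * h)‖ ≤ C := by
    obtain ⟨C, hC⟩ := ((Finset.Icc ⌊min a b / h⌋ ⌊max a b / h⌋).image
      fun z : ℤ => ‖F ((z : ℝ) * h)‖).bddAbove
    exact ⟨C, fun z hz => hC (Finset.mem_coe.2 (Finset.mem_image_of_mem _ hz))⟩
  refine (intervalIntegrable_const (c := C)).mono_fun' hmeas.aestronglyMeasurable ?_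
  refine (ae_restrict_mem measurableSet_uIoc).mono fun s hs => ?_
  rw [uIoc, mem_Ioc] at hs
  refine hC _ (Finset.mem_Icc.2 ⟨?_, ?_⟩)
  · exact Int.floor_mono (div_le_div_of_nonneg_right hs.1.le hh.le)
  · exact Int.floor_mono (div_le_div_of_nonneg_right hs.2 hh.le)

/-- Gronwall estimate for the retarded system with piecewise-constant arguments on an interval
`[a, b]`, with the whole history up to `a` bounded by `D`. -/
lemma norm_add_le_of_flr_integral_eq {E : Type*} [NormedAddCommGroup E] [NormedSpace ℝ E]
    {T h a b D F G L1 L2 : ℝ} {f : ℝ → E → E → E} {g : ℝ → E → ℝ → ℝ}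
    {x : ℝ → E} {τ : ℝ → ℝ} (hh : 0 < h) (ha : 0 ≤ a) (hbT : b ≤ T)
    (hL1 : 0 ≤ L1) (hL2 : 0 ≤ L2) (hF : 0 ≤ F) (hG : 0 ≤ G)
    (hf : ∀ t ∈ Icc (0 : ℝ) T, ∀ u v, ‖f t u v‖ ≤ F + L1 * (‖u‖ + ‖v‖))
    (hg : ∀ t ∈ Icc (0 : ℝ) T, ∀ u w, |g t u w| ≤ G + L2 * (‖u‖ + |w|))
    (hτ0 : ∀ r ≤ b, 0 ≤ τ r)
    (hD : ∀ r ≤ a, ‖x r‖ + τ r ≤ D)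
    (hx : ∀ t ∈ Icc a b, x t = x a + ∫ s in a..t,
      f (flr h s) (x (flr h s)) (x (flr h s - flr h (τ (flr h s)))))
    (hτ : ∀ t ∈ Icc a b, τ t = τ a + ∫ s in a..t, g (flr h s) (x (flr h s)) (τ (flr h s))) :
    ∀ t ∈ Icc a b,
      ‖x t‖ + τ t ≤ (D + (F + G) * (t - a)) * Real.exp (2 * (L1 + L2) * (t - a)) := by
  intro t ht
  have hab : a ≤ b := ht.1.trans ht.2
  have hD0 : 0 ≤ D := (add_nonneg (norm_nonneg _) (hτ0 a hab)).trans (hD a le_rfl)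
  set B : ℝ → ℝ := fun t => (D + (F + G) * (t - a)) * Real.exp (2 * (L1 + L2) * (t - a)) with hB
  have hBa : B a = D := by simp [hB]
  have hBmono : ∀ r s, a ≤ r → r ≤ s → B r ≤ B s := by
    intro r s hr hrs
    have : 0 ≤ (F + G) * (s - a) := mul_nonneg (by positivity) (by linarith)
    simp only [hB]
    gcongr
  have hBD : ∀ s, a ≤ s → D ≤ B s := fun s hs => hBa ▸ hBmono a s le_rfl hs
  have hBcont : Continuous B := by fun_prop
  have hderiv : ∀ s, HasDerivAt B
      ((F + G) * Real.exp (2 * (L1 + L2) * (s - a)) + 2 * (L1 + L2) * B s) s := by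
    intro s
    have h1 : HasDerivAt (fun t => D + (F + G) * (t - a)) (F + G) s := by
      simpa using (((hasDerivAt_id s).sub_const a).const_mul (F + G)).const_add D
    have h2 : HasDerivAt (fun t => 2 * (L1 + L2) * (t - a)) (2 * (L1 + L2)) s := by
      simpa using ((hasDerivAt_id s).sub_const a).const_mul (2 * (L1 + L2))
    refine (h1.mul h2.exp).congr_deriv ?_
    simp only [hB]
    ring
  suffices H : ∀ m : ℕ, ∀ t ∈ Icc a b, t ≤ m * h → ‖x t‖ + τ t ≤ B t by
    obtain ⟨m, hm⟩ := exists_nat_ge (t / h)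
    exact H m t ht ((div_le_iff₀ hh).1 hm)
  intro m
  induction m with
  | zero =>
    intro t ht htm
    have : t = a := by
      have := ht.1
      simp only [Nat.cast_zero, zero_mul] at htm
      linarith
    rw [this, hBa]
    exact hD a le_rfl
  | succ m ih =>
    intro t ht htm
    push_cast at htm
    have hpast : ∀ s, a ≤ s → s < t → ∀ r ≤ flr h s, ‖x r‖ + τ r ≤ B s := by
      intro s has hst r hr
      have hrs : r ≤ s := hr.trans (flr_le hh s)
      rcases le_or_gt r a with hra | hra
      · exact (hD r hra).trans (hBD s has)
      · exact (ih r ⟨hra.le, hrs.trans (hst.le.trans ht.2)⟩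
          (hr.trans (flr_le_of_lt hh (hst.trans_le htm)))).trans (hBmono r s hra.le hrs)
    have hflr : ∀ s, a ≤ s → s < t → flr h s ∈ Icc 0 T ∧ flr h s ≤ b := fun s has hst =>
      have h1 : flr h s ≤ b := (flr_le hh s).trans (hst.le.trans ht.2)
      ⟨⟨flr_nonneg hh (ha.trans has), h1.trans hbT⟩, h1⟩
    have hne : ∀ᵐ s : ℝ, s ≠ t := by simp [ae_iff, measure_singleton]
    have hxb : ‖∫ s in a..t, f (flr h s) (x (flr h s)) (x (flr h s - flr h (τ (flr h s))))‖
        ≤ ∫ s in a..t, (F + L1 * (B s + B s)) := by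
      refine intervalIntegral.norm_integral_le_of_norm_le ht.1 ?_
        (Continuous.intervalIntegrable (by fun_prop) _ _)
      filter_upwards [hne] with s hst hs
      have hst' : s < t := lt_of_le_of_ne hs.2 hst
      obtain ⟨hr, hrb⟩ := hflr s hs.1.le hst'
      have hdel : flr h s - flr h (τ (flr h s)) ≤ flr h s :=
        sub_le_self _ (flr_nonneg hh (hτ0 _ hrb))
      have h1 := hpast s hs.1.le hst' _ le_rfl
      have h2 := hpast s hs.1.le hst' _ hdel
      have h3 := hτ0 _ hrb
      have h4 := hτ0 _ (hdel.trans hrb)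
      refine (hf _ hr _ _).trans ?_
      gcongr <;> linarith
    have hτb : ‖∫ s in a..t, g (flr h s) (x (flr h s)) (τ (flr h s))‖
        ≤ ∫ s in a..t, (G + L2 * B s) := by
      refine intervalIntegral.norm_integral_le_of_norm_le ht.1 ?_
        (Continuous.intervalIntegrable (by fun_prop) _ _)
      filter_upwards [hne] with s hst hs
      have hst' : s < t := lt_of_le_of_ne hs.2 hst
      obtain ⟨hr, hrb⟩ := hflr s hs.1.le hst'
      refine (hg _ hr _ _).trans ?_
      rw [abs_of_nonneg (hτ0 _ hrb)]
      gcongr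
      exact hpast s hs.1.le hst' _ le_rfl
    have hint : (∫ s in a..t, (F + L1 * (B s + B s))) + (∫ s in a..t, (G + L2 * B s))
        ≤ B t - B a := by
      rw [← intervalIntegral.integral_add (Continuous.intervalIntegrable (by fun_prop) _ _)
        (Continuous.intervalIntegrable (by fun_prop) _ _),
        ← intervalIntegral.integral_eq_sub_of_hasDerivAt (fun s _ => hderiv s)
          (Continuous.intervalIntegrable (by fun_prop) _ _)]
      refine intervalIntegral.integral_mono_on ht.1
        (Continuous.intervalIntegrable (by fun_prop) _ _)
        (Continuous.intervalIntegrable (by fun_prop) _ _) fun s hs => ?_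
      have h1 : 1 ≤ Real.exp (2 * (L1 + L2) * (s - a)) :=
        Real.one_le_exp (mul_nonneg (by positivity) (by linarith [hs.1]))
      have h2 : F + G ≤ (F + G) * Real.exp (2 * (L1 + L2) * (s - a)) :=
        le_mul_of_one_le_right (by positivity) h1
      have h3 : 0 ≤ L2 * B s := mul_nonneg hL2 (hD0.trans (hBD s hs.1))
      linarith
    have hxt : ‖x t‖ ≤ ‖x a‖ + ∫ s in a..t, (F + L1 * (B s + B s)) := by
      rw [hx t ht]
      exact (norm_add_le _ _).trans (by gcongr)
    have hτt : τ t ≤ τ a + ∫ s in a..t, (G + L2 * B s) := by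
      rw [hτ t ht]
      gcongr
      exact (Real.le_norm_self _).trans hτb
    have := hD a le_rfl
    linarith

/-- The a priori estimate (3.16): under (A1)–(A4) with `f` and `g` globally
Lipschitz (constants `L₁`, `L₂` independent of `M`), if `(x_h,τ_h)` is a
solution of the EPCA impulsive initial value problem on `(-∞,β]` with
`0 < h < h₀` and `τ_h ≥ 0` on `[0,β]`, then with `L = L₁ + L₂`, for all
`t ∈ [0,β]`:
`‖x_h(t)‖ + τ_h(t) ≤ (N_φ + λ + T·max_{[0,T]}‖f(s,0,0)‖
  + T·max_{[0,T]}|g(s,0,0)| + max_k ‖I_k(0)‖)·(Σ_{j=0}^K (1+L₃)^j)·e^{2Lt}`. -/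
theorem stmt15 (n K : ℕ) (T lam : ℝ) (hT : 0 < T) (hlam : 0 < lam)
    (f : ℝ → (Fin n → ℝ) → (Fin n → ℝ) → (Fin n → ℝ))
    (g : ℝ → (Fin n → ℝ) → ℝ → ℝ) (Imp : ℕ → (Fin n → ℝ) → (Fin n → ℝ))
    (φ : ℝ → (Fin n → ℝ)) (tm : ℕ → ℝ)
    -- (A1) with a global Lipschitz constant `L₁`:
    (hfc : ContinuousOn (fun p : ℝ × (Fin n → ℝ) × (Fin n → ℝ) => f p.1 p.2.1 p.2.2)
      (Icc 0 T ×ˢ (univ : Set (Fin n → ℝ)) ×ˢ (univ : Set (Fin n → ℝ))))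
    (L1 : ℝ) (hL1 : 0 ≤ L1)
    (hfL : ∀ t ∈ Icc (0 : ℝ) T, ∀ u ub v vb : Fin n → ℝ,
      ‖f t u v - f t ub vb‖ ≤ L1 * (‖u - ub‖ + ‖v - vb‖))
    -- (A2) with a global Lipschitz constant `L₂`:
    (hgc : ContinuousOn (fun p : ℝ × (Fin n → ℝ) × ℝ => g p.1 p.2.1 p.2.2)
      (Icc 0 T ×ˢ (univ : Set (Fin n → ℝ)) ×ˢ (univ : Set ℝ)))
    (hgpos : ∀ t ∈ Icc (0 : ℝ) T, ∀ u : Fin n → ℝ, 0 < g t u 0)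
    (L2 : ℝ) (hL2 : 0 ≤ L2)
    (hgL : ∀ t ∈ Icc (0 : ℝ) T, ∀ u ub : Fin n → ℝ, ∀ w wb : ℝ,
      |g t u w - g t ub wb| ≤ L2 * (‖u - ub‖ + |w - wb|))
    -- (A3) with Lipschitz constant `L₃`:
    (L3 : ℝ) (hL3 : 0 ≤ L3)
    (hImpL : ∀ k, 1 ≤ k → k ≤ K → ∀ u ub : Fin n → ℝ,
      ‖Imp k u - Imp k ub‖ ≤ L3 * ‖u - ub‖)
    -- (A4): `φ` bounded by `N_φ`, piecewise Lipschitz: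
    (Nφ : ℝ) (hNφ0 : 0 ≤ Nφ) (hNφ : ∀ s ≤ (0 : ℝ), ‖φ s‖ ≤ Nφ)
    (hA4 : AssumptionA4 n φ tm)
    -- the impulsive moments and the stepsize `0 < h < h₀`:
    (tI : ℕ → ℝ) (htI0 : tI 0 = 0) (htIK : tI (K + 1) = T)
    (htImono : ∀ k ≤ K, tI k < tI (k + 1))
    (h0 : ℝ) (hh0min : ∀ k ≤ K, h0 ≤ tI (k + 1) - tI k)
    (hh0mem : ∃ k ≤ K, h0 = tI (k + 1) - tI k)
    (h : ℝ) (hh : 0 < h) (hhh0 : h < h0)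
    -- the EPCA solution on `(-∞,β]` with nonnegative delay component:
    (β : ℝ) (hβ0 : 0 < β) (hβT : β ≤ T)
    (x : ℝ → (Fin n → ℝ)) (τ : ℝ → ℝ)
    (hsol : IsEPCASol n K f g Imp φ lam tI h β x τ)
    (hτnn : ∀ t ∈ Icc (0 : ℝ) β, 0 ≤ τ t) :
    ∀ t ∈ Icc (0 : ℝ) β,
      ‖x t‖ + τ t ≤
        (Nφ + lam + T * sSup ((fun s => ‖f s 0 0‖) '' Icc (0 : ℝ) T)
          + T * sSup ((fun s => |g s 0 0|) '' Icc (0 : ℝ) T)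
          + sSup ((fun k => ‖Imp k 0‖) '' {k : ℕ | 1 ≤ k ∧ k ≤ K})) *
        (∑ j ∈ Finset.range (K + 1), (1 + L3) ^ j) *
        Real.exp (2 * (L1 + L2) * t) := by
  obtain ⟨hxφ, hτlam, hτc, hτeq, -, hjump, hxeq⟩ := hsol
  set F := sSup ((fun s => ‖f s 0 0‖) '' Icc (0 : ℝ) T) with hFdef
  set G := sSup ((fun s => |g s 0 0|) '' Icc (0 : ℝ) T) with hGdef
  set J := sSup ((fun k => ‖Imp k 0‖) '' {k : ℕ | 1 ≤ k ∧ k ≤ K}) with hJdef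
  have hF : ∀ s ∈ Icc (0 : ℝ) T, ‖f s 0 0‖ ≤ F := by
    have hc : ContinuousOn (fun s => f s 0 0) (Icc (0 : ℝ) T) :=
      hfc.comp (f := fun s : ℝ => (s, (0 : Fin n → ℝ), (0 : Fin n → ℝ))) (by fun_prop)
        fun s hs => ⟨hs, mem_univ _, mem_univ _⟩
    exact fun s hs => le_csSup (isCompact_Icc.bddAbove_image hc.norm) (mem_image_of_mem _ hs)
  have hG : ∀ s ∈ Icc (0 : ℝ) T, |g s 0 0| ≤ G := by
    have hc : ContinuousOn (fun s => g s 0 0) (Icc (0 : ℝ) T) :=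
      hgc.comp (f := fun s : ℝ => (s, (0 : Fin n → ℝ), (0 : ℝ))) (by fun_prop)
        fun s hs => ⟨hs, mem_univ _, mem_univ _⟩
    exact fun s hs => le_csSup (isCompact_Icc.bddAbove_image hc.abs) (mem_image_of_mem _ hs)
  have hJ : ∀ k, 1 ≤ k → k ≤ K → ‖Imp k 0‖ ≤ J := by
    have hfin : {k : ℕ | 1 ≤ k ∧ k ≤ K}.Finite := (finite_Icc 1 K).subset fun k hk => hk
    exact fun k h1 h2 => le_csSup (hfin.image _).bddAbove (mem_image_of_mem _ ⟨h1, h2⟩)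
  have h0T : (0 : ℝ) ∈ Icc 0 T := ⟨le_rfl, hT.le⟩
  have hF0 : 0 ≤ F := (norm_nonneg _).trans (hF 0 h0T)
  have hG0 : 0 ≤ G := (abs_nonneg _).trans (hG 0 h0T)
  have hJ0 : 0 ≤ J := Real.sSup_nonneg (by rintro _ ⟨k, -, rfl⟩; exact norm_nonneg _)
  clear_value F G J
  have hf : ∀ t ∈ Icc (0 : ℝ) T, ∀ u v, ‖f t u v‖ ≤ F + L1 * (‖u‖ + ‖v‖) := by
    intro t ht u v
    have h1 := hfL t ht u 0 v 0
    have h2 := norm_le_norm_add_norm_sub' (f t u v) (f t 0 0)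
    simp only [sub_zero] at h1
    linarith [hF t ht]
  have hg : ∀ t ∈ Icc (0 : ℝ) T, ∀ u w, |g t u w| ≤ G + L2 * (‖u‖ + |w|) := by
    intro t ht u w
    have h1 := hgL t ht u 0 w 0
    have h2 := norm_le_norm_add_norm_sub' (g t u w) (g t 0 0)
    simp only [sub_zero, Real.norm_eq_abs] at h1 h2
    linarith [hG t ht]
  have hImp : ∀ k, 1 ≤ k → k ≤ K → ∀ u, ‖Imp k u‖ ≤ J + L3 * ‖u‖ := by
    intro k hk hkK u
    have h1 := hImpL k hk hkK u 0
    have h2 := norm_le_norm_add_norm_sub' (Imp k u) (Imp k 0)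
    simp only [sub_zero] at h1
    linarith [hJ k hk hkK]
  have hτ0 : ∀ r ≤ β, 0 ≤ τ r := by
    intro r hr
    rcases le_or_gt r 0 with h1 | h1
    · exact (hτlam r h1).symm ▸ hlam.le
    · exact hτnn r ⟨h1.le, hr⟩
  have htI : ∀ j ≤ K + 1, ∀ i ≤ j, tI i ≤ tI j := by
    intro j
    induction j with
    | zero =>
      intro _ i hi
      rw [Nat.le_zero.1 hi]
    | succ j ih =>
      intro hj i hi
      rcases Nat.le_succ_iff.1 hi with hi | rfl
      · exact (ih (by omega) i hi).trans (htImono j (by omega)).le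
      · exact le_rfl
  have htI0' : ∀ k ≤ K, 0 ≤ tI k := fun k hk => htI0 ▸ htI k (by omega) 0 (Nat.zero_le k)
  have hτint : ∀ a ∈ Icc 0 β, ∀ t ∈ Icc a β,
      τ t = τ a + ∫ s in a..t, g (flr h s) (x (flr h s)) (τ (flr h s)) := by
    intro a ha t ht
    have hi := intervalIntegrable_comp_flr hh fun r => g r (x r) (τ r)
    rw [hτeq t ⟨ha.1.trans ht.1, ht.2⟩, hτeq a ha, add_assoc,
      intervalIntegral.integral_add_adjacent_intervals (hi 0 a) (hi a t)]
  set C := Nφ + lam + T * F + T * G + J with hC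
  have hC0 : 0 ≤ C := by positivity
  set S : ℕ → ℝ := fun k => ∑ j ∈ Finset.range (k + 1), (1 + L3) ^ j with hS
  have hSsucc : ∀ k, S (k + 1) = (1 + L3) * S k + 1 := by
    intro k
    simp only [hS]
    rw [Finset.sum_range_succ' _ (k + 1), Finset.mul_sum]
    simp [pow_succ']
  have hSmono : Monotone S := fun i j hij =>
    Finset.sum_le_sum_of_subset_of_nonneg
      (Finset.range_subset_range.2 (Nat.succ_le_succ hij)) fun _ _ _ => by positivity
  have hS0 : ∀ k, 0 ≤ S k := fun k => Finset.sum_nonneg fun _ _ => by positivity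
  set α := 2 * (L1 + L2) with hα
  have hα0 : 0 ≤ α := by positivity
  have hstep : ∀ k ≤ K,
      (∀ r ≤ tI k, ‖x r‖ + τ r ≤ (C * S k - (F + G) * T) * Real.exp (α * tI k)) →
      ∀ t, tI k ≤ t → t ≤ β → (∀ i, 1 ≤ i → i ≤ K → tI i ∉ Ioc (tI k) t) →
        ‖x t‖ + τ t ≤ C * S k * Real.exp (α * t) := by
    intro k hk hP t hkt htβ hno
    have hk0 := htI0' k hk
    have key := norm_add_le_of_flr_integral_eq hh hk0 (htβ.trans hβT) hL1 hL2 hF0 hG0 hf hg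
      (fun r hr => hτ0 r (hr.trans htβ)) hP
      (fun s hs => hxeq (tI k) s hk0 hs.1 (hs.2.trans htβ)
        fun i h1 h2 h3 => hno i h1 h2 ⟨h3.1, h3.2.trans hs.2⟩)
      (fun s hs => hτint _ ⟨hk0, hkt.trans htβ⟩ s ⟨hs.1, hs.2.trans htβ⟩) t ⟨hkt, le_rfl⟩
    have h1 : 1 ≤ Real.exp (α * tI k) := Real.one_le_exp (by positivity)
    have h2 : (F + G) * (t - tI k) ≤ (F + G) * T * Real.exp (α * tI k) :=
      (mul_le_mul_of_nonneg_left (by linarith) (by positivity)).trans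
        (le_mul_of_one_le_right (by positivity) h1)
    have h3 : Real.exp (α * t) = Real.exp (α * tI k) * Real.exp (α * (t - tI k)) := by
      rw [← Real.exp_add]
      ring_nf
    rw [h3, ← mul_assoc]
    refine key.trans (mul_le_mul_of_nonneg_right ?_ (Real.exp_pos _).le)
    linarith
  have hno : ∀ k ≤ K, ∀ t < tI (k + 1), ∀ i, 1 ≤ i → i ≤ K → tI i ∉ Ioc (tI k) t := by
    intro k hk t ht i _ hi hmem
    rcases Nat.lt_or_ge k i with hki | hki
    · exact absurd (hmem.2.trans_lt ht) (htI i (by omega) (k + 1) hki).not_gt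
    · exact absurd hmem.1 (htI k (by omega) i hki).not_gt
  have hhist : ∀ k ≤ K, tI k ≤ β →
      ∀ r ≤ tI k, ‖x r‖ + τ r ≤ (C * S k - (F + G) * T) * Real.exp (α * tI k) := by
    intro k
    induction k with
    | zero =>
      intro _ _ r hr
      rw [htI0] at hr ⊢
      have hS00 : S 0 = 1 := by simp [hS]
      rw [hxφ r hr, hτlam r hr, hS00]
      simp only [mul_zero, Real.exp_zero, mul_one]
      linarith [hNφ r hr]
    | succ k ih =>
      intro hk hkβ
      have hlt := htImono k (by omega)
      have hk0 := htI0' k (by omega)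
      have hpre := ih (by omega) (hlt.le.trans hkβ)
      have hmid : ∀ t, tI k ≤ t → t < tI (k + 1) →
          ‖x t‖ + τ t ≤ C * S k * Real.exp (α * tI (k + 1)) := by
        intro t h1 h2
        refine (hstep k (by omega) hpre t h1 (h2.le.trans hkβ) (hno k (by omega) t h2)).trans ?_
        have := hS0 k
        gcongr
      have hE : 1 ≤ Real.exp (α * tI (k + 1)) :=
        Real.one_le_exp (mul_nonneg hα0 (hk0.trans hlt.le))
      have hCS : (1 + L3) * (C * S k) + J ≤ C * S (k + 1) - (F + G) * T := by
        rw [hSsucc]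
        linarith
      have hgrow : (1 + L3) * (C * S k * Real.exp (α * tI (k + 1))) + J ≤
          (C * S (k + 1) - (F + G) * T) * Real.exp (α * tI (k + 1)) := by
        have h1 := mul_le_mul_of_nonneg_right hCS (Real.exp_pos (α * tI (k + 1))).le
        have h2 := le_mul_of_one_le_right hJ0 hE
        linarith
      have hM0 : 0 ≤ C * S k * Real.exp (α * tI (k + 1)) :=
        mul_nonneg (mul_nonneg hC0 (hS0 k)) (Real.exp_pos _).le
      have hweak : C * S k * Real.exp (α * tI (k + 1)) ≤
          (C * S (k + 1) - (F + G) * T) * Real.exp (α * tI (k + 1)) := by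
        linarith [mul_nonneg hL3 hM0]
      intro r hr
      rcases lt_or_eq_of_le hr with hr | rfl
      · rcases le_total (tI k) r with h1 | h1
        · exact (hmid r h1 hr).trans hweak
        · refine ((hpre r h1).trans ?_).trans hweak
          have h2 : 0 ≤ (F + G) * T := by positivity
          have h3 : Real.exp (α * tI k) ≤ Real.exp (α * tI (k + 1)) := by gcongr
          exact mul_le_mul (by linarith) h3 (Real.exp_pos _).le (mul_nonneg hC0 (hS0 k))
      · obtain ⟨ξ, hξ, hxξ⟩ := hjump (k + 1) (by omega) hk hkβ
        have hτlim : Tendsto τ (nhdsWithin (tI (k + 1)) (Iio (tI (k + 1))))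
            (nhds (τ (tI (k + 1)))) := by
          have hpos : 0 < tI (k + 1) := hk0.trans_lt hlt
          refine (hτc _ ⟨hpos.le, hkβ⟩).mono_left (nhdsWithin_le_iff.2 ?_)
          exact mem_of_superset (Ioo_mem_nhdsLT hpos) fun s hs => ⟨hs.1.le, hs.2.le.trans hkβ⟩
        have hlim : ‖ξ‖ + τ (tI (k + 1)) ≤ C * S k * Real.exp (α * tI (k + 1)) :=
          le_of_tendsto (hξ.norm.add hτlim) (mem_of_superset (Ioo_mem_nhdsLT hlt)
            fun s hs => hmid s hs.1.le hs.2)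
        have h1 : ‖x (tI (k + 1))‖ ≤ ‖ξ‖ + (J + L3 * ‖ξ‖) := by
          rw [hxξ]
          exact (norm_add_le _ _).trans (by gcongr; exact hImp (k + 1) (by omega) hk ξ)
        have h2 : L3 * ‖ξ‖ ≤ L3 * (C * S k * Real.exp (α * tI (k + 1))) :=
          mul_le_mul_of_nonneg_left (by linarith [hτ0 _ hkβ]) hL3
        linarith
  intro t ht
  set k := Nat.findGreatest (fun k => tI k ≤ t) K with hk
  have hkK : k ≤ K := Nat.findGreatest_le K
  have hkt : tI k ≤ t :=
    Nat.findGreatest_spec (P := fun k => tI k ≤ t) (Nat.zero_le K) (htI0.trans_le ht.1)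
  have hbound := hstep k hkK (hhist k hkK (hkt.trans ht.2)) t hkt ht.2 fun i _ hi hmem => by
    rcases Nat.lt_or_ge k i with hki | hki
    · exact Nat.findGreatest_is_greatest hki hi hmem.2
    · exact absurd hmem.1 (htI k (by omega) i hki).not_gt
  exact hbound.trans (by gcongr; exact hSmono hkK)
end
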